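/- arXiv:0711.1520 — 3 statements merged into one kernel-verified Lean document; each statement's English description precedes it below -/
import Mathlib

section
/- For n ≥ 2 and any homogeneous elliptic polynomial P of degree d > 0 with positive coefficients in n+1 variables, as t → ∞: #{m ∈ ℕ^{n+1} : P(m) ≤ t^d and gcd(m₁,…,m_{n+1}) = 1} ~ (1/ζ(n+1))·#{m ∈ ℕ^{n+1} : P(m) ≤ t^d}. -/
open Finset Asymptotics Filter

lemma eval_smul_hom {n d : ℕ} (P : MvPolynomial (Fin (n + 1)) ℝ)
    (hhom : P.IsHomogeneous d) (c : ℝ) (x : Fin (n + 1) → ℝ) :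
    MvPolynomial.eval (c • x) P = c ^ d * MvPolynomial.eval x P := by
  rw [MvPolynomial.eval_eq', MvPolynomial.eval_eq', Finset.mul_sum]
  refine Finset.sum_congr rfl fun m hm => ?_
  have h := hhom (MvPolynomial.mem_support_iff.mp hm)
  rw [Finsupp.weight_apply, Finsupp.sum_fintype _ _ (by simp)] at h
  simp only [Pi.one_apply, smul_eq_mul, mul_one] at h
  simp only [Pi.smul_apply, smul_eq_mul, mul_pow, Finset.prod_mul_distrib]
  rw [Finset.prod_pow_eq_pow_sum, h]
  ring

lemma eval_mono_nonneg {n : ℕ} (P : MvPolynomial (Fin (n + 1)) ℝ)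
    (hcoef : ∀ m ∈ P.support, 0 < P.coeff m) (x y : Fin (n + 1) → ℝ)
    (hx : ∀ i, 0 ≤ x i) (hxy : ∀ i, x i ≤ y i) :
    MvPolynomial.eval x P ≤ MvPolynomial.eval y P := by
  rw [MvPolynomial.eval_eq', MvPolynomial.eval_eq']
  refine Finset.sum_le_sum fun m hm => ?_
  refine mul_le_mul_of_nonneg_left ?_ (hcoef m hm).le
  exact Finset.prod_le_prod (fun i _ => pow_nonneg (hx i) _)
    (fun i _ => pow_le_pow_left₀ (hx i) (hxy i) _)

lemma eval_bound {n d : ℕ} (hd : 0 < d) (P : MvPolynomial (Fin (n + 1)) ℝ)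
    (hhom : P.IsHomogeneous d)
    (hcoef : ∀ m ∈ P.support, 0 < P.coeff m)
    (hell : ∀ x : Fin (n + 1) → ℝ, (∀ i, 0 ≤ x i) → x ≠ 0 →
      0 < MvPolynomial.eval x P) :
    ∃ C : ℝ, 0 < C ∧ ∀ t : ℝ, 0 ≤ t → ∀ x : Fin (n + 1) → ℝ, (∀ i, 0 ≤ x i) →
      MvPolynomial.eval x P ≤ t ^ d → ∀ i, x i ≤ C * t := by
  set δ : Fin (n + 1) → ℝ := fun i => MvPolynomial.eval (Pi.single i (1 : ℝ)) P with hδ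
  have hs0 : ∀ i j : Fin (n + 1), 0 ≤ (Pi.single i (1 : ℝ) : Fin (n + 1) → ℝ) j := by
    intro i j
    by_cases h : j = i
    · subst h; simp
    · simp [h]
  have hpos : ∀ i, 0 < δ i := fun i => hell _ (hs0 i) (by simp)
  have hsum : 0 ≤ ∑ i, (δ i)⁻¹ := Finset.sum_nonneg fun i _ => (inv_pos.2 (hpos i)).le
  refine ⟨1 + ∑ i, (δ i)⁻¹, by linarith, ?_⟩
  intro t ht x hx hP i
  set C := 1 + ∑ i, (δ i)⁻¹
  have h1 : (x i) ^ d * δ i ≤ t ^ d := by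
    rw [hδ, ← eval_smul_hom P hhom]
    refine (eval_mono_nonneg P hcoef _ _ ?_ ?_).trans hP
    · intro j; exact mul_nonneg (hx i) (hs0 i j)
    · intro j
      by_cases h : j = i
      · subst h; simp
      · simp [h, hx j]
  have hC1 : 1 ≤ C := by simp only [C]; linarith
  have h2 : (δ i)⁻¹ ≤ C ^ d := by
    refine le_trans ?_ (le_self_pow₀ hC1 hd.ne')
    have := Finset.single_le_sum (f := fun i => (δ i)⁻¹) (fun i _ => (inv_pos.2 (hpos i)).le)
      (Finset.mem_univ i)
    simp only [C]; linarith
  refine le_of_pow_le_pow_left₀ hd.ne' (by positivity) ?_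
  rw [mul_pow]
  calc x i ^ d = (δ i)⁻¹ * (x i ^ d * δ i) := by field_simp [(hpos i).ne']
    _ ≤ C ^ d * t ^ d := mul_le_mul h2 h1 (mul_nonneg (pow_nonneg (hx i) _) (hpos i).le) (by positivity)

/-- the points counted -/
def cset {n : ℕ} (d : ℕ) (f : (Fin (n + 1) → ℝ) → ℝ) (t : ℝ) : Set (Fin (n + 1) → ℕ) :=
  {m | (∀ i, 0 < m i) ∧ f (fun i => (m i : ℝ)) ≤ t ^ d}

lemma cset_sub {n d : ℕ} {f : (Fin (n + 1) → ℝ) → ℝ} {C : ℝ} (_hC : 0 < C)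
    (hb : ∀ t : ℝ, 0 ≤ t → ∀ x : Fin (n + 1) → ℝ, (∀ i, 0 ≤ x i) →
      f x ≤ t ^ d → ∀ i, x i ≤ C * t) {t : ℝ} (ht : 0 ≤ t) :
    cset d f t ⊆ ↑(Fintype.piFinset fun _ : Fin (n + 1) => Finset.Icc 1 ⌊C * t⌋₊) := by
  intro m hm
  simp only [Finset.mem_coe, Fintype.mem_piFinset, Finset.mem_Icc]
  intro i
  exact ⟨hm.1 i, Nat.le_floor (hb t ht _ (fun i => Nat.cast_nonneg _) hm.2 i)⟩

lemma cset_finite {n d : ℕ} {f : (Fin (n + 1) → ℝ) → ℝ} {C : ℝ} (hC : 0 < C)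
    (hb : ∀ t : ℝ, 0 ≤ t → ∀ x : Fin (n + 1) → ℝ, (∀ i, 0 ≤ x i) →
      f x ≤ t ^ d → ∀ i, x i ≤ C * t) {t : ℝ} (ht : 0 ≤ t) :
    (cset d f t).Finite :=
  (Finset.finite_toSet _).subset (cset_sub hC hb ht)

lemma cset_card_le {n d : ℕ} {f : (Fin (n + 1) → ℝ) → ℝ} {C : ℝ} (hC : 0 < C)
    (hb : ∀ t : ℝ, 0 ≤ t → ∀ x : Fin (n + 1) → ℝ, (∀ i, 0 ≤ x i) →
      f x ≤ t ^ d → ∀ i, x i ≤ C * t) {t : ℝ} (ht : 0 ≤ t) :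
    (Nat.card (cset d f t) : ℝ) ≤ (C * t) ^ (n + 1) := by
  have h := Nat.card_mono (Finset.finite_toSet _) (cset_sub hC hb ht)
  rw [Nat.card_eq_fintype_card (α := ↑(↑(Fintype.piFinset fun _ : Fin (n + 1) => Finset.Icc 1 ⌊C * t⌋₊) : Set (Fin (n + 1) → ℕ)))] at h
  simp only [Fintype.card_coe, Finset.coe_sort_coe, Fintype.card_piFinset, Nat.card_Icc, Finset.prod_const,
    Finset.card_univ, Fintype.card_fin, add_tsub_cancel_right] at h
  calc (Nat.card (cset d f t) : ℝ) ≤ ((⌊C * t⌋₊ ^ (n + 1) : ℕ) : ℝ) := by exact_mod_cast h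
    _ ≤ _ := by
      push_cast
      gcongr
      exact Nat.floor_le (by positivity)

open ArithmeticFunction in
lemma moebius_sum_gcd (g K : ℕ) (hg : 0 < g) (hK : g ≤ K) :
    (if g = 1 then (1 : ℝ) else 0) =
      ∑ k ∈ Finset.Icc 1 K, if k ∣ g then ((moebius k : ℤ) : ℝ) else 0 := by
  have h : (∑ k ∈ g.divisors, moebius k) = if g = 1 then (1 : ℤ) else 0 := by
    rw [← coe_mul_zeta_apply, moebius_mul_coe_zeta, one_apply]
  rw [← Finset.sum_filter]
  have h2 : (Finset.Icc 1 K).filter (fun k => k ∣ g) = g.divisors := by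
    ext k
    simp only [Finset.mem_filter, Finset.mem_Icc, Nat.mem_divisors]
    constructor
    · rintro ⟨_, h⟩; exact ⟨h, hg.ne'⟩
    · rintro ⟨h, _⟩; exact ⟨⟨Nat.pos_of_dvd_of_pos h hg, (Nat.le_of_dvd hg h).trans hK⟩, h⟩
  rw [h2]
  have := congrArg (fun z : ℤ => (z : ℝ)) h
  push_cast at this
  exact this.symm

lemma cset_div_card {n d : ℕ} {f : (Fin (n + 1) → ℝ) → ℝ}
    (hh : ∀ (c : ℝ) x, f (c • x) = c ^ d * f x) (t : ℝ) (k : ℕ) (hk : 0 < k) :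
    Nat.card (cset d f (t / k)) =
      Nat.card {m | m ∈ cset d f t ∧ k ∣ Finset.univ.gcd m} := by
  have hk' : (0 : ℝ) < (k : ℝ) ^ d := by positivity
  have key : ∀ m : Fin (n + 1) → ℕ, (fun j => k * m j) ∈ cset d f t ↔ m ∈ cset d f (t / k) := by
    intro m
    simp only [cset, Set.mem_ofPred_eq]
    have e : (fun i => ((k * m i : ℕ) : ℝ)) = (k : ℝ) • (fun i => (m i : ℝ)) := by
      ext i; simp
    rw [e, hh, div_pow, le_div_iff₀ hk', mul_comm]
    simp [hk]
  have himg : {m | m ∈ cset d f t ∧ k ∣ Finset.univ.gcd m} =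
      (fun (m : Fin (n + 1) → ℕ) j => k * m j) '' cset d f (t / k) := by
    ext m
    constructor
    · rintro ⟨h1, h2⟩
      rw [Finset.dvd_gcd_iff] at h2
      choose q hq using fun i => h2 i (Finset.mem_univ i)
      have : m = fun j => k * q j := funext hq
      subst this
      exact ⟨q, (key q).1 h1, rfl⟩
    · rintro ⟨q, hq, rfl⟩
      exact ⟨(key q).2 hq, Finset.dvd_gcd fun i _ => dvd_mul_right _ _⟩
  rw [himg, Nat.card_image_of_injective]
  intro a b hab
  ext i
  exact Nat.eq_of_mul_eq_mul_left hk (congrFun hab i)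

open ArithmeticFunction in
lemma coprime_card_eq {n d : ℕ} {f : (Fin (n + 1) → ℝ) → ℝ} {C : ℝ} (hC : 0 < C)
    (hb : ∀ t : ℝ, 0 ≤ t → ∀ x : Fin (n + 1) → ℝ, (∀ i, 0 ≤ x i) →
      f x ≤ t ^ d → ∀ i, x i ≤ C * t)
    (hh : ∀ (c : ℝ) x, f (c • x) = c ^ d * f x) {t : ℝ} (ht : 0 ≤ t) :
    (Nat.card {m | m ∈ cset d f t ∧ Finset.univ.gcd m = 1} : ℝ) =
      ∑' k : ℕ, ((moebius k : ℤ) : ℝ) * (Nat.card (cset d f (t / k)) : ℝ) := by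
  classical
  have hfin := cset_finite hC hb ht
  set S := hfin.toFinset with hS
  have hcard : ∀ (p : (Fin (n + 1) → ℕ) → Prop) [DecidablePred p],
      (Nat.card {m | m ∈ cset d f t ∧ p m} : ℝ) = ∑ m ∈ S, if p m then (1 : ℝ) else 0 := by
    intro p _
    rw [Finset.sum_boole, Nat.cast_inj, Nat.subtype_card]
    intro m
    simp [hS]
  have hgpos : ∀ m ∈ S, 0 < Finset.univ.gcd m := by
    intro m hm
    have hm' : m ∈ cset d f t := by simpa [hS] using hm
    refine Nat.pos_of_ne_zero fun h => ?_
    rw [Finset.gcd_eq_zero_iff] at h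
    exact (hm'.1 0).ne' (h 0 (Finset.mem_univ _))
  set K := ∑ m ∈ S, Finset.univ.gcd m with hK
  have hgle : ∀ m ∈ S, Finset.univ.gcd m ≤ K := fun m hm =>
    Finset.single_le_sum (f := fun m => Finset.univ.gcd m) (fun _ _ => Nat.zero_le _) hm
  rw [tsum_eq_sum (s := Finset.Icc 1 K)]
  · rw [hcard, Finset.sum_congr rfl fun m hm => moebius_sum_gcd _ K (hgpos m hm) (hgle m hm),
      Finset.sum_comm]
    refine Finset.sum_congr rfl fun k hk => ?_
    rw [cset_div_card hh t k (Finset.mem_Icc.1 hk).1, hcard, Finset.mul_sum]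
    refine Finset.sum_congr rfl fun m _ => ?_
    simp
  · intro k hk
    rcases Nat.eq_zero_or_pos k with rfl | hk0
    · simp
    · have : K < k := by
        by_contra h
        exact hk (Finset.mem_Icc.2 ⟨hk0, not_lt.1 h⟩)
      rw [cset_div_card hh t k hk0, hcard, Finset.sum_eq_zero, mul_zero]
      intro m hm
      rw [if_neg]
      intro hdvd
      exact absurd (Nat.le_of_dvd (hgpos m hm) hdvd) (by have := hgle m hm; omega)

open ArithmeticFunction in
lemma moebius_tsum (N : ℕ) (hN : 2 ≤ N) :
    ∑' k : ℕ, ((moebius k : ℤ) : ℝ) / (k : ℝ) ^ N = (∑' k : ℕ, (1 : ℝ) / (k + 1) ^ N)⁻¹ := by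
  have hs : 1 < ((N : ℂ)).re := by simp; omega
  have h := LSeries_one_mul_Lseries_moebius hs
  rw [LSeries_one_eq_riemannZeta hs, zeta_eq_tsum_one_div_nat_add_one_cpow hs] at h
  have h1 : (∑' n : ℕ, 1 / ((n : ℂ) + 1) ^ (N : ℂ)) = ((∑' k : ℕ, (1 : ℝ) / (k + 1) ^ N : ℝ) : ℂ) := by
    rw [Complex.ofReal_tsum]
    refine tsum_congr fun k => ?_
    push_cast
    rw [Complex.cpow_natCast]
  have h2 : LSeries (fun n => ((moebius n : ℤ) : ℂ)) (N : ℂ) =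
      ((∑' k : ℕ, ((moebius k : ℤ) : ℝ) / (k : ℝ) ^ N : ℝ) : ℂ) := by
    rw [Complex.ofReal_tsum, LSeries]
    refine tsum_congr fun k => ?_
    rcases Nat.eq_zero_or_pos k with rfl | hk
    · simp
    · rw [LSeries.term_of_ne_zero hk.ne', Complex.cpow_natCast]
      push_cast
      rfl
  rw [h1, h2] at h
  refine eq_inv_of_mul_eq_one_right ?_
  exact_mod_cast h

open MeasureTheory in
lemma level_null {n d : ℕ} (hd : 0 < d) {f : (Fin (n + 1) → ℝ) → ℝ} (hf : Continuous f)
    (hh : ∀ (c : ℝ) x, f (c • x) = c ^ d * f x) :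
    volume {x | f x = 1} = 0 := by
  by_contra hne
  have hc := Measure.countable_meas_level_set_pos (μ := (volume : Measure (Fin (n + 1) → ℝ)))
    hf.measurable
  have hsub : Set.Ioi (0 : ℝ) ⊆ {t : ℝ | 0 < (volume : Measure (Fin (n + 1) → ℝ)) {a | f a = t}} := by
    intro t ht
    have ht' : (0 : ℝ) < t := ht
    set r : ℝ := t ^ ((d : ℝ)⁻¹) with hr
    have hr0 : 0 < r := Real.rpow_pos_of_pos ht' _
    have hrd : r ^ d = t := Real.rpow_inv_natCast_pow ht'.le hd.ne'
    have e : {a : Fin (n + 1) → ℝ | f a = t} = (fun x => r⁻¹ • x) ⁻¹' {x | f x = 1} := by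
      ext a
      simp only [Set.mem_preimage, Set.mem_ofPred_eq, hh, inv_pow, hrd]
      rw [inv_mul_eq_one₀ ht'.ne', eq_comm]
    simp only [Set.mem_ofPred_eq]
    rw [e, Measure.addHaar_preimage_smul _ (inv_ne_zero hr0.ne')]
    refine pos_iff_ne_zero.2 (mul_ne_zero ?_ hne)
    simp [hr0.ne']
  have h1 := (Cardinal.le_aleph0_iff_set_countable).2 (hc.mono hsub)
  rw [Cardinal.mk_Ioi_real] at h1
  exact absurd h1 (not_le.2 Cardinal.aleph0_lt_continuum)

open MeasureTheory Pointwise in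
lemma cset_tendsto {n d : ℕ} (hd : 0 < d) {f : (Fin (n + 1) → ℝ) → ℝ} {C : ℝ} (hC : 0 < C)
    (hb : ∀ t : ℝ, 0 ≤ t → ∀ x : Fin (n + 1) → ℝ, (∀ i, 0 ≤ x i) →
      f x ≤ t ^ d → ∀ i, x i ≤ C * t) (hf : Continuous f)
    (hh : ∀ (c : ℝ) x, f (c • x) = c ^ d * f x) :
    ∃ c : ℝ, 0 < c ∧ Tendsto (fun t : ℝ => (Nat.card (cset d f t) : ℝ) / t ^ (n + 1)) atTop
      (nhds c) := by
  set s : Set (Fin (n + 1) → ℝ) := {x | (∀ i, 0 < x i) ∧ f x ≤ 1} with hs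
  have hU : IsOpen {x : Fin (n + 1) → ℝ | ∀ i, 0 < x i} := by
    simp only [Set.ofPred_forall]
    exact isOpen_iInter_of_finite fun i => isOpen_lt continuous_const (continuous_apply i)
  have hbdd : Bornology.IsBounded s := by
    refine (Metric.isBounded_Icc (0 : Fin (n + 1) → ℝ) (fun _ => C)).subset ?_
    intro x hx
    refine ⟨fun i => (hx.1 i).le, fun i => ?_⟩
    have := hb 1 zero_le_one x (fun i => (hx.1 i).le) (by simpa using hx.2) i
    simpa using this
  have hmeas : MeasurableSet s :=
    hU.measurableSet.inter (isClosed_le hf continuous_const).measurableSet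
  have hfr : volume (frontier s) = 0 := by
    have hsub : frontier s ⊆ (⋃ i, {x : Fin (n + 1) → ℝ | x i = 0}) ∪ {x | f x = 1} := by
      intro x hx
      have hcl : x ∈ {x : Fin (n + 1) → ℝ | (∀ i, 0 ≤ x i) ∧ f x ≤ 1} := by
        have hclosed : IsClosed {x : Fin (n + 1) → ℝ | (∀ i, 0 ≤ x i) ∧ f x ≤ 1} := by
          refine IsClosed.inter ?_ (isClosed_le hf continuous_const)
          change IsClosed {x : Fin (n + 1) → ℝ | ∀ i, 0 ≤ x i}
          simp only [Set.ofPred_forall]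
          exact isClosed_iInter fun i => isClosed_le continuous_const (continuous_apply i)
        have hsc : s ⊆ {x : Fin (n + 1) → ℝ | (∀ i, 0 ≤ x i) ∧ f x ≤ 1} :=
          fun y hy => ⟨fun i => (hy.1 i).le, hy.2⟩
        exact closure_minimal hsc hclosed hx.1
      by_contra hcon
      simp only [Set.mem_union, Set.mem_iUnion, Set.mem_ofPred_eq, not_or, not_exists] at hcon
      refine hx.2 ?_
      have hV : IsOpen {x : Fin (n + 1) → ℝ | (∀ i, 0 < x i) ∧ f x < 1} :=
        hU.inter (isOpen_lt hf continuous_const)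
      have hVs : {x : Fin (n + 1) → ℝ | (∀ i, 0 < x i) ∧ f x < 1} ⊆ s :=
        fun y hy => ⟨hy.1, hy.2.le⟩
      refine interior_maximal hVs hV ?_
      exact ⟨fun i => lt_of_le_of_ne (hcl.1 i) (Ne.symm (hcon.1 i)), lt_of_le_of_ne hcl.2 hcon.2⟩
    refine measure_mono_null hsub (measure_union_null (measure_iUnion_null fun i => ?_)
      (level_null hd hf hh))
    have := Measure.pi_hyperplane (fun _ : Fin (n + 1) => (volume : Measure ℝ)) i 0
    simpa [volume_pi] using this
  have hmem : ∀ r : ℝ, 0 < r → ∀ x : Fin (n + 1) → ℝ, x ∈ r • s ↔ (∀ i, 0 < x i) ∧ f x ≤ r ^ d := by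
    intro r hr x
    rw [Set.mem_smul_set_iff_inv_smul_mem₀ hr.ne']
    simp only [hs, Set.mem_ofPred_eq, hh, Pi.smul_apply, smul_eq_mul, inv_pow]
    rw [inv_mul_le_iff₀ (by positivity), mul_one]
    simp [hr]
  have hmono : ∀ ⦃x y : ℝ⦄, 0 < x → x ≤ y → x • s ⊆ y • s := by
    intro x y hx hxy z hz
    rw [hmem _ hx] at hz
    rw [hmem _ (hx.trans_le hxy)]
    exact ⟨hz.1, hz.2.trans (by gcongr)⟩
  have key := tendsto_card_div_pow_atTop_volume' s hbdd hmeas hfr hmono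
  refine ⟨volume.real s, ?_, ?_⟩
  · rw [measureReal_def]
    refine ENNReal.toReal_pos ?_ hbdd.measure_lt_top.ne
    have hV : IsOpen {x : Fin (n + 1) → ℝ | (∀ i, 0 < x i) ∧ f x < 1} :=
      hU.inter (isOpen_lt hf continuous_const)
    have hne : {x : Fin (n + 1) → ℝ | (∀ i, 0 < x i) ∧ f x < 1}.Nonempty := by
      set M := |f (fun _ => 1)| + 1 with hM
      have hM1 : 1 ≤ M := by rw [hM]; linarith [abs_nonneg (f (fun _ => 1))]
      have hM0 : 0 < M := by linarith
      refine ⟨M⁻¹ • (fun _ => 1), fun i => by simp [hM0], ?_⟩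
      rw [hh, inv_pow, inv_mul_lt_iff₀ (by positivity), mul_one]
      calc f (fun _ => 1) ≤ |f (fun _ => 1)| := le_abs_self _
        _ < M := by rw [hM]; linarith
        _ ≤ M ^ d := le_self_pow₀ hM1 hd.ne'
    have hpos := hV.measure_pos volume hne
    have hVs : {x : Fin (n + 1) → ℝ | (∀ i, 0 < x i) ∧ f x < 1} ⊆ s :=
      fun y hy => ⟨hy.1, hy.2.le⟩
    exact (hpos.trans_le (measure_mono hVs)).ne'
  · refine key.congr' ?_
    filter_upwards [eventually_gt_atTop 0] with t ht
    rw [Fintype.card_fin]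
    congr 2
    have himg : s ∩ t⁻¹ • (Submodule.span ℤ (Set.range (Pi.basisFun ℝ (Fin (n + 1)))) : Set (Fin (n + 1) → ℝ)) =
        (fun (m : Fin (n + 1) → ℕ) => t⁻¹ • (fun i => (m i : ℝ))) '' cset d f t := by
      have hL : ∀ x : Fin (n + 1) → ℝ, x ∈ t⁻¹ • (Submodule.span ℤ (Set.range (Pi.basisFun ℝ (Fin (n + 1)))) : Set (Fin (n + 1) → ℝ)) ↔
          ∀ i, ∃ z : ℤ, (z : ℝ) = t * x i := by
        intro x
        rw [Set.mem_smul_set_iff_inv_smul_mem₀ (inv_ne_zero ht.ne'), SetLike.mem_coe,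
          Module.Basis.mem_span_iff_repr_mem]
        simp
      ext x
      rw [Set.mem_inter_iff, hL]
      constructor
      · rintro ⟨hx, hz⟩
        choose z hz using hz
        have hz0 : ∀ i, 0 < z i := by
          intro i
          have : (0 : ℝ) < z i := by rw [hz]; exact mul_pos ht (hx.1 i)
          exact_mod_cast this
        have hcast : (fun i => (((z i).toNat : ℕ) : ℝ)) = t • x := by
          ext i
          have : (((z i).toNat : ℤ) : ℝ) = (z i : ℝ) := by rw [Int.toNat_of_nonneg (hz0 i).le]
          rw [Int.cast_natCast, hz] at this
          exact this
        refine ⟨fun i => (z i).toNat, ⟨fun i => Int.pos_iff_toNat_pos.1 (hz0 i), ?_⟩, ?_⟩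
        · rw [hcast, hh]
          exact mul_le_of_le_one_right (by positivity) hx.2
        · simp only [hcast]
          rw [smul_smul, inv_mul_cancel₀ ht.ne', one_smul]
      · rintro ⟨m, hm, rfl⟩
        refine ⟨⟨fun i => ?_, ?_⟩, fun i => ⟨m i, ?_⟩⟩
        · have : (0 : ℝ) < m i := by exact_mod_cast hm.1 i
          simp only [Pi.smul_apply, smul_eq_mul]
          positivity
        · rw [hh, inv_pow, inv_mul_le_iff₀ (by positivity), mul_one]
          exact hm.2
        · simp [ht.ne']
    rw [himg, Nat.card_image_of_injective]
    intro a b hab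
    ext i
    have := congrFun hab i
    simpa [ht.ne'] using this

open ArithmeticFunction in
theorem stmt4_aux {n d : ℕ} (hn : 2 ≤ n) (hd : 0 < d) {f : (Fin (n + 1) → ℝ) → ℝ} {C : ℝ}
    (hC : 0 < C)
    (hb : ∀ t : ℝ, 0 ≤ t → ∀ x : Fin (n + 1) → ℝ, (∀ i, 0 ≤ x i) →
      f x ≤ t ^ d → ∀ i, x i ≤ C * t) (hf : Continuous f)
    (hh : ∀ (c : ℝ) x, f (c • x) = c ^ d * f x) :
    (fun t : ℝ => (Nat.card {m | m ∈ cset d f t ∧ Finset.univ.gcd m = 1} : ℝ))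
      ~[atTop]
    (fun t : ℝ => (∑' k : ℕ, (1 : ℝ) / (k + 1) ^ (n + 1))⁻¹ * (Nat.card (cset d f t) : ℝ)) := by
  obtain ⟨c, hc, hlim⟩ := cset_tendsto hd hC hb hf hh
  set Z := (∑' k : ℕ, (1 : ℝ) / (k + 1) ^ (n + 1))⁻¹ with hZ
  have hsumm : Summable fun k : ℕ => (1 : ℝ) / (k : ℝ) ^ (n + 1) :=
    Real.summable_one_div_nat_pow.2 (by omega)
  have hZpos : 0 < Z := by
    rw [hZ, inv_pos]
    have h1 : Summable fun k : ℕ => (1 : ℝ) / ((k : ℝ) + 1) ^ (n + 1) := by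
      simpa using (summable_nat_add_iff 1).2 hsumm
    exact h1.tsum_pos (fun k => by positivity) 0 (by simp)
  have hB : Tendsto (fun t : ℝ =>
      (Nat.card {m | m ∈ cset d f t ∧ Finset.univ.gcd m = 1} : ℝ) / t ^ (n + 1)) atTop
      (nhds (Z * c)) := by
    have hT : Tendsto (fun t : ℝ => ∑' k : ℕ, ((moebius k : ℤ) : ℝ) / (k : ℝ) ^ (n + 1) *
        ((Nat.card (cset d f (t / k)) : ℝ) / (t / k) ^ (n + 1))) atTop
        (nhds (∑' k : ℕ, ((moebius k : ℤ) : ℝ) / (k : ℝ) ^ (n + 1) * c)) := by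
      refine tendsto_tsum_of_dominated_convergence
        (bound := fun k : ℕ => 1 / (k : ℝ) ^ (n + 1) * C ^ (n + 1)) (hsumm.mul_right _) ?_ ?_
      · intro k
        rcases Nat.eq_zero_or_pos k with rfl | hk
        · simp
        · refine Tendsto.const_mul _ (hlim.comp (tendsto_id.atTop_div_const ?_))
          exact_mod_cast hk
      · filter_upwards [eventually_gt_atTop 0] with t ht k
        rcases Nat.eq_zero_or_pos k with rfl | hk
        · simp
        · have hk' : (0 : ℝ) < k := by exact_mod_cast hk
          have htk : 0 < t / k := div_pos ht hk'
          rw [norm_mul, norm_div, norm_div, Real.norm_eq_abs, Real.norm_eq_abs, Real.norm_eq_abs,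
            Real.norm_eq_abs, abs_of_pos (pow_pos hk' _), abs_of_pos (pow_pos htk _),
            Nat.abs_cast]
          have hmu : |((moebius k : ℤ) : ℝ)| ≤ 1 := by
            exact_mod_cast (abs_moebius_le_one (n := k))
          refine mul_le_mul ?_ ?_ (by positivity) (by positivity)
          · gcongr
          · rw [div_le_iff₀ (pow_pos htk _), ← mul_pow]
            exact cset_card_le hC hb htk.le
    rw [tsum_mul_right, moebius_tsum (n + 1) (by omega)] at hT
    refine hT.congr' ?_
    filter_upwards [eventually_gt_atTop 0] with t ht
    rw [coprime_card_eq hC hb hh ht.le, ← tsum_div_const]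
    refine tsum_congr fun k => ?_
    rcases Nat.eq_zero_or_pos k with rfl | hk
    · simp
    · have hk' : (k : ℝ) ≠ 0 := by positivity
      rw [div_pow]
      field_simp
  have hA : Tendsto (fun t : ℝ => Z * (Nat.card (cset d f t) : ℝ) / t ^ (n + 1)) atTop
      (nhds (Z * c)) := by
    simpa only [mul_div_assoc] using hlim.const_mul Z
  have hne : Z * c ≠ 0 := (mul_pos hZpos hc).ne'
  have hAne : ∀ᶠ t : ℝ in atTop, Z * (Nat.card (cset d f t) : ℝ) ≠ 0 := by
    filter_upwards [hA.eventually_ne hne] with t ht h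
    exact ht (by rw [h, zero_div])
  rw [isEquivalent_iff_tendsto_one hAne]
  have hq := hB.div hA hne
  rw [div_self hne] at hq
  refine hq.congr' ?_
  filter_upwards [eventually_gt_atTop 0] with t ht
  simp only [Pi.div_apply]
  rw [div_div_div_cancel_right₀ (by positivity)]

/-- for `n ≥ 2` and an elliptic homogeneous polynomial `P` of degree
`d > 0` with positive coefficients in `n+1` variables, the number of points of
`ℕ^{n+1}` with `P(m) ≤ t^d` and jointly coprime coordinates is asymptotically
`1/ζ(n+1)` times the number of all points of `ℕ^{n+1}` with `P(m) ≤ t^d`. -/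
theorem stmt4 (n d : ℕ) (hn : 2 ≤ n) (hd : 0 < d)
    (P : MvPolynomial (Fin (n + 1)) ℝ)
    (hhom : P.IsHomogeneous d)
    (hcoef : ∀ m ∈ P.support, 0 < P.coeff m)
    (hell : ∀ x : Fin (n + 1) → ℝ, (∀ i, 0 ≤ x i) → x ≠ 0 →
      0 < MvPolynomial.eval x P) :
    (fun t : ℝ => (Nat.card {m : Fin (n + 1) → ℕ | (∀ i, 0 < m i) ∧
        MvPolynomial.eval (fun i => (m i : ℝ)) P ≤ t ^ d ∧
        Finset.univ.gcd m = 1} : ℝ))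
      ~[atTop]
    (fun t : ℝ => (∑' k : ℕ, (1 : ℝ) / (k + 1) ^ (n + 1))⁻¹ *
        (Nat.card {m : Fin (n + 1) → ℕ | (∀ i, 0 < m i) ∧
          MvPolynomial.eval (fun i => (m i : ℝ)) P ≤ t ^ d} : ℝ)) := by
  obtain ⟨C, hC, hb⟩ := eval_bound hd P hhom hcoef hell
  have h := stmt4_aux hn hd hC hb (f := fun x => MvPolynomial.eval x P)
    (MvPolynomial.continuous_eval P) (eval_smul_hom P hhom)
  simpa only [cset, Set.mem_ofPred_eq, and_assoc] using h
end

section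
/- With f, g, S*(g), 𝓔(f), 𝓕₀(f), and normalized polar vector c as above (𝓕₀(f) compact), the Euler product G(f;0) = ∏_p [(1 − 1/p)^{Σ_{ν ∈ 𝓕₀(f)∩S*(g)} g(ν)} · Σ_{ν∈ℕ₀ⁿ} g(ν)/p^{⟨ν,c⟩}] converges to a strictly positive real number. -/
open Finset

lemma aux_summable_prod (n : ℕ) (r : ℝ) (h0 : 0 ≤ r) (h1 : r < 1) :
    Summable (fun ν : Fin n → ℕ => ∏ i, r ^ (ν i)) := by
  classical
  refine summable_of_sum_le (c := ∏ _i : Fin n, (1 - r)⁻¹) (fun ν => by positivity) ?_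
  intro u
  let N : ℕ := u.sup (fun ν => ∑ i, ν i) + 1
  have hsub : u ⊆ Fintype.piFinset (fun _ : Fin n => Finset.range N) := by
    intro ν hν
    rw [Fintype.mem_piFinset]
    intro i
    rw [Finset.mem_range]
    have h2 : ν i ≤ ∑ i, ν i := Finset.single_le_sum (fun _ _ => Nat.zero_le _) (Finset.mem_univ i)
    have h3 : (∑ i, ν i) ≤ u.sup (fun ν => ∑ i, ν i) :=
      Finset.le_sup (f := fun ν : Fin n → ℕ => ∑ i, ν i) hν
    omega
  calc ∑ ν ∈ u, ∏ i, r ^ (ν i)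
      ≤ ∑ ν ∈ Fintype.piFinset (fun _ : Fin n => Finset.range N), ∏ i, r ^ (ν i) :=
        Finset.sum_le_sum_of_subset_of_nonneg hsub (fun _ _ _ => by positivity)
    _ = ∏ _i : Fin n, ∑ k ∈ Finset.range N, r ^ k := by rw [Finset.prod_univ_sum]
    _ ≤ ∏ _i : Fin n, (1 - r)⁻¹ := by
        refine Finset.prod_le_prod (fun _ _ => by positivity) (fun _ _ => ?_)
        rw [← tsum_geometric_of_lt_one h0 h1]
        exact (summable_geometric_of_lt_one h0 h1).sum_le_tsum _ (fun _ _ => by positivity)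

lemma aux_summable (n : ℕ) (g : (Fin n → ℕ) → ℕ) (C M : ℝ) (hC : 0 < C) (hM : 0 < M)
    (hg : ∀ ν, (g ν : ℝ) ≤ C * (1 + ∑ i, (ν i : ℝ)) ^ M)
    (c : Fin n → ℝ) (hcpos : ∀ i, 0 < c i) :
    Summable (fun ν : Fin n → ℕ => (g ν : ℝ) * (2 : ℝ) ^ (-∑ i, (ν i : ℝ) * c i)) := by
  obtain ⟨m, hm, hmc⟩ : ∃ m : ℝ, 0 < m ∧ ∀ i, m ≤ c i := by
    rcases isEmpty_or_nonempty (Fin n) with h | h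
    · exact ⟨1, one_pos, fun i => isEmptyElim i⟩
    · obtain ⟨i, hi⟩ := Finite.exists_min c
      exact ⟨c i, hcpos i, hi⟩
  have hl2 : 0 < Real.log 2 := Real.log_pos (by norm_num)
  set q : ℝ := m * Real.log 2 / 2 with hq
  have hqpos : 0 < q := by positivity
  set ε : ℝ := q / M with hε
  have hεpos : 0 < ε := by positivity
  have hMε : M * ε = q := by rw [hε]; field_simp
  have key : ∀ s : ℝ, 0 ≤ s → (1 + s) ^ M ≤
      Real.exp (q + M * (-1 - Real.log ε)) * Real.exp (q * s) := by
    intro s hs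
    have hz : 0 < 1 + s := by linarith
    have h1 := Real.log_le_sub_one_of_pos (mul_pos hεpos hz)
    rw [Real.log_mul hεpos.ne' hz.ne'] at h1
    rw [Real.rpow_def_of_pos hz, ← Real.exp_add, Real.exp_le_exp]
    have h2 : M * Real.log (1 + s) ≤ M * (ε * (1 + s) - 1 - Real.log ε) :=
      mul_le_mul_of_nonneg_left (by linarith) hM.le
    have h3 : M * (ε * (1 + s) - 1 - Real.log ε) = M * ε * (1 + s) + M * (-1 - Real.log ε) := by
      ring
    rw [h3, hMε] at h2
    linarith
  set A := Real.exp (q + M * (-1 - Real.log ε)) with hA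
  refine Summable.of_nonneg_of_le (fun ν => by positivity) ?_
    ((aux_summable_prod n (Real.exp (-q)) (Real.exp_pos _).le
      (by rw [Real.exp_lt_one_iff]; linarith)).mul_left (C * A))
  intro ν
  have hs : (0 : ℝ) ≤ ∑ i, (ν i : ℝ) := Finset.sum_nonneg (fun _ _ => by positivity)
  have hw : m * ∑ i, (ν i : ℝ) ≤ ∑ i, (ν i : ℝ) * c i := by
    rw [Finset.mul_sum]
    refine Finset.sum_le_sum (fun i _ => ?_)
    rw [mul_comm]
    exact mul_le_mul_of_nonneg_left (hmc i) (by positivity)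
  have hprod : ∏ i, Real.exp (-q) ^ (ν i) = Real.exp (-q * ∑ i, (ν i : ℝ)) := by
    rw [Finset.mul_sum, Real.exp_sum]
    refine Finset.prod_congr rfl (fun i _ => ?_)
    rw [← Real.exp_nat_mul, mul_comm]
  rw [hprod]
  calc (g ν : ℝ) * (2 : ℝ) ^ (-∑ i, (ν i : ℝ) * c i)
      ≤ (C * (A * Real.exp (q * ∑ i, (ν i : ℝ)))) *
          Real.exp (-(2 * q) * ∑ i, (ν i : ℝ)) := by
        refine mul_le_mul ((hg ν).trans (mul_le_mul_of_nonneg_left (key _ hs) hC.le)) ?_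
          (by positivity) (by positivity)
        rw [Real.rpow_def_of_pos (by norm_num), Real.exp_le_exp]
        have := mul_le_mul_of_nonneg_left hw hl2.le
        rw [hq]
        linarith
    _ = C * A * Real.exp (-q * ∑ i, (ν i : ℝ)) := by
        rw [mul_assoc, mul_assoc, mul_assoc, ← Real.exp_add]
        congr 3
        ring

lemma aux_log_bound (k B R x d : ℝ) (hk : 0 ≤ k) (hB : 0 ≤ B) (hR : 0 ≤ R) (hx0 : 0 < x)
    (hx : x ≤ 1 / 2) (hRd : R ≤ B * d) (hdx : d ≤ x) (hxd : x ^ 2 ≤ d) :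
    |k * Real.log (1 - x) + Real.log (1 + (k * x + R))| ≤ (2 * k + B + (k + B) ^ 2) * d := by
  have hd : 0 ≤ d := (sq_nonneg x).trans hxd
  set y := k * x + R with hy
  have hy0 : 0 ≤ y := by positivity
  have u1 := Real.log_le_sub_one_of_pos (show 0 < 1 - x by linarith)
  have u2 := Real.log_le_sub_one_of_pos (show 0 < 1 + y by linarith)
  have l1 := Real.one_sub_inv_le_log_of_pos (show 0 < 1 - x by linarith)
  have l2 := Real.one_sub_inv_le_log_of_pos (show 0 < 1 + y by linarith)
  have l1' : -x - 2 * x ^ 2 ≤ 1 - (1 - x)⁻¹ := by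
    have h : 0 < 1 - x := by linarith
    have : (1 - x)⁻¹ ≤ 1 + x + 2 * x ^ 2 := by
      rw [inv_le_iff_one_le_mul₀ h]
      nlinarith [mul_nonneg (sq_nonneg x) (show 0 ≤ 1 - 2 * x by linarith)]
    linarith
  have l2' : y - y ^ 2 ≤ 1 - (1 + y)⁻¹ := by
    have h : 0 < 1 + y := by linarith
    have : (1 + y)⁻¹ ≤ 1 - y + y ^ 2 := by
      rw [inv_le_iff_one_le_mul₀ h]
      nlinarith [pow_nonneg hy0 3]
    linarith
  have hyx : y ≤ (k + B) * x := by
    have : B * d ≤ B * x := mul_le_mul_of_nonneg_left hdx hB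
    rw [hy]; linarith
  have hy2 : y ^ 2 ≤ (k + B) ^ 2 * d := by
    calc y ^ 2 ≤ ((k + B) * x) ^ 2 := by gcongr
      _ = (k + B) ^ 2 * x ^ 2 := by ring
      _ ≤ _ := by gcongr
  have hk1 : k * Real.log (1 - x) ≤ k * (-x) := mul_le_mul_of_nonneg_left (by linarith) hk
  have hk2 : k * (-x - 2 * x ^ 2) ≤ k * Real.log (1 - x) :=
    mul_le_mul_of_nonneg_left (by linarith) hk
  have hk3 : k * x ^ 2 ≤ k * d := mul_le_mul_of_nonneg_left hxd hk
  have hkd : 0 ≤ k * d := by positivity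
  have hsq : 0 ≤ (k + B) ^ 2 * d := by positivity
  have hBd : 0 ≤ B * d := by positivity
  rw [abs_le]
  constructor <;> nlinarith

lemma aux_main {ι : Type*} (g : ι → ℕ) (w : ι → ℝ) (o : ι) (hgo : g o = 1) (hwo : w o = 0)
    (hsum : Summable (fun ν => (g ν : ℝ) * (2 : ℝ) ^ (-w ν)))
    (hw : ∀ ν, ν ≠ o → g ν ≠ 0 → 1 ≤ w ν) :
    ∃ L : ℝ, 0 < L ∧
      HasProd (fun p : Nat.Primes =>
        (1 - 1 / ((p : ℕ) : ℝ)) ^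
            (∑' ν : {ν : ι // ν ≠ o ∧ g ν ≠ 0 ∧ w ν = 1}, (g ν.1 : ℝ)) *
          ∑' ν : ι, (g ν : ℝ) * ((p : ℕ) : ℝ) ^ (-w ν)) L := by
  classical
  -- finiteness
  have hfin : {ν | g ν ≠ 0 ∧ w ν ≤ 2}.Finite := by
    have h := hsum.tendsto_cofinite_zero.eventually (gt_mem_nhds (show (0:ℝ) < 1 / 4 by norm_num))
    rw [Filter.eventually_cofinite] at h
    refine h.subset ?_
    rintro ν ⟨h1, h2⟩
    simp only [Set.mem_ofPred_eq, not_lt]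
    have h3 : (1 : ℝ) ≤ g ν := by exact_mod_cast Nat.one_le_iff_ne_zero.mpr h1
    have h4 : (1 / 4 : ℝ) ≤ (2 : ℝ) ^ (-w ν) := by
      calc (1 / 4 : ℝ) = (2 : ℝ) ^ (-2 : ℝ) := by
            rw [Real.rpow_neg (by norm_num)]; norm_num
        _ ≤ _ := Real.rpow_le_rpow_of_exponent_le (by norm_num) (by linarith)
    nlinarith
  obtain ⟨δ, hδ, hδ1, hgap⟩ : ∃ δ : ℝ, 0 < δ ∧ δ ≤ 1 ∧ ∀ ν, g ν ≠ 0 → 1 < w ν → 1 + δ ≤ w ν := by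
    have hfin2 : ((fun ν => w ν - 1) '' {ν | (g ν ≠ 0 ∧ w ν ≤ 2) ∧ 1 < w ν} ∪ {1}).Finite :=
      ((hfin.subset (fun ν h => h.1)).image _).union (Set.finite_singleton _)
    obtain ⟨d, hd, hmin⟩ := Set.exists_min_image _ id hfin2 ⟨1, by simp⟩
    refine ⟨d, ?_, hmin 1 (by simp), ?_⟩
    · rcases hd with ⟨ν, h, rfl⟩ | h
      · have := h.2
        simp only; linarith
      · rw [Set.mem_singleton_iff] at h; rw [h]; exact one_pos
    · intro ν h1 h2
      by_cases h3 : w ν ≤ 2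
      · have := hmin (w ν - 1) (Or.inl ⟨ν, ⟨⟨h1, h3⟩, h2⟩, rfl⟩)
        simp only [id] at this
        linarith
      · have := hmin 1 (by simp)
        simp only [id] at this
        linarith
  have hTfin : {ν | ν ≠ o ∧ g ν ≠ 0 ∧ w ν = 1}.Finite :=
    hfin.subset (fun ν h => ⟨h.2.1, by rw [h.2.2]; norm_num⟩)
  set T := hTfin.toFinset with hT
  have hk : (∑' ν : {ν : ι // ν ≠ o ∧ g ν ≠ 0 ∧ w ν = 1}, (g ν.1 : ℝ)) = ∑ ν ∈ T, (g ν : ℝ) := by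
    rw [← Finset.tsum_subtype]
    exact (Equiv.tsum_eq (Equiv.subtypeEquivRight (fun ν => by simp [hT]))
      (fun ν : {x // x ∈ T} => (g ν.1 : ℝ)))
  rw [hk]
  set k := ∑ ν ∈ T, (g ν : ℝ) with hkdef
  have hk0 : 0 ≤ k := Finset.sum_nonneg (fun _ _ => by positivity)
  set D := ∑' ν, (g ν : ℝ) * (2 : ℝ) ^ (-w ν) with hD
  have hD0 : 0 ≤ D := tsum_nonneg (fun _ => by positivity)
  set B := (2 : ℝ) ^ (1 + δ) * D with hB
  have hB0 : 0 ≤ B := by positivity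
  have hwnn : ∀ ν, g ν ≠ 0 → 0 ≤ w ν := by
    intro ν h
    by_cases ho : ν = o
    · rw [ho, hwo]
    · linarith [hw ν ho h]
  have hoT : o ∉ T := by simp [hT]
  -- decomposition of the local factor
  have hlocal : ∀ p : Nat.Primes, ∃ R : ℝ, 0 ≤ R ∧ R ≤ B * ((p : ℕ) : ℝ) ^ (-(1 + δ)) ∧
      ∑' ν : ι, (g ν : ℝ) * ((p : ℕ) : ℝ) ^ (-w ν) = 1 + (k * (1 / ((p : ℕ) : ℝ)) + R) := by
    intro p
    have hp2 : (2 : ℝ) ≤ ((p : ℕ) : ℝ) := by exact_mod_cast p.2.two_le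
    have hp0 : (0 : ℝ) < ((p : ℕ) : ℝ) := by linarith
    set P : ℝ := ((p : ℕ) : ℝ) with hP
    have hsp : Summable (fun ν => (g ν : ℝ) * P ^ (-w ν)) := by
      refine Summable.of_nonneg_of_le (fun ν => by positivity) (fun ν => ?_) hsum
      by_cases h : g ν = 0
      · simp [h]
      · refine mul_le_mul_of_nonneg_left ?_ (by positivity)
        exact Real.rpow_le_rpow_of_nonpos (by norm_num) hp2 (by linarith [hwnn ν h])
    refine ⟨∑' ν : (((insert o T : Finset ι) : Set ι)ᶜ : Set ι), (g ν : ℝ) * P ^ (-w ν),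
      tsum_nonneg (fun _ => by positivity), ?_, ?_⟩
    · have hs2 : Summable (fun ν : (((insert o T : Finset ι) : Set ι)ᶜ : Set ι) =>
          (g ν : ℝ) * (2 : ℝ) ^ (-w ν)) := hsum.subtype _
      have hcD : ∑' ν : (((insert o T : Finset ι) : Set ι)ᶜ : Set ι),
          (g ν : ℝ) * (2 : ℝ) ^ (-w ν) ≤ D :=
        hsum.tsum_subtype_le (fun ν => (g ν : ℝ) * (2 : ℝ) ^ (-w ν)) _ (fun _ => by positivity)
      calc ∑' ν : (((insert o T : Finset ι) : Set ι)ᶜ : Set ι), (g ν : ℝ) * P ^ (-w ν)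
          ≤ ∑' ν : (((insert o T : Finset ι) : Set ι)ᶜ : Set ι),
            (P ^ (-(1 + δ)) * (2 : ℝ) ^ (1 + δ)) * ((g ν : ℝ) * (2 : ℝ) ^ (-w ν)) := by
            refine (hsp.subtype _).tsum_le_tsum (fun ν => ?_) (hs2.mul_left _)
            obtain ⟨ν, hν⟩ := ν
            simp only [Function.comp]
            by_cases h : g ν = 0
            · simp [h]
            · have hν' : ν ≠ o ∧ ν ∉ T := by simpa using hν
              have h1 := hw ν hν'.1 h
              have h2 : w ν ≠ 1 := fun h2 => hν'.2 (by simp [hT, hν'.1, h, h2])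
              have h3 := hgap ν h (lt_of_le_of_ne h1 (Ne.symm h2))
              have e1 : P ^ (-w ν) = P ^ (-(1 + δ)) * P ^ (-(w ν - (1 + δ))) := by
                rw [← Real.rpow_add hp0]; congr 1; ring
              have e2 : (2 : ℝ) ^ (1 + δ) * (2 : ℝ) ^ (-w ν) = 2 ^ (-(w ν - (1 + δ))) := by
                rw [← Real.rpow_add (by norm_num)]; congr 1; ring
              have e3 : P ^ (-(w ν - (1 + δ))) ≤ 2 ^ (-(w ν - (1 + δ))) :=
                Real.rpow_le_rpow_of_nonpos (by norm_num) hp2 (by linarith)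
              calc (g ν : ℝ) * P ^ (-w ν)
                  = (g ν : ℝ) * P ^ (-(1 + δ)) * P ^ (-(w ν - (1 + δ))) := by rw [e1]; ring
                _ ≤ (g ν : ℝ) * P ^ (-(1 + δ)) * 2 ^ (-(w ν - (1 + δ))) :=
                    mul_le_mul_of_nonneg_left e3 (by positivity)
                _ = _ := by rw [← e2]; ring
        _ = (P ^ (-(1 + δ)) * (2 : ℝ) ^ (1 + δ)) *
            ∑' ν : (((insert o T : Finset ι) : Set ι)ᶜ : Set ι),
              ((g ν : ℝ) * (2 : ℝ) ^ (-w ν)) := tsum_mul_left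
        _ ≤ (P ^ (-(1 + δ)) * (2 : ℝ) ^ (1 + δ)) * D :=
            mul_le_mul_of_nonneg_left hcD (by positivity)
        _ = B * P ^ (-(1 + δ)) := by rw [hB]; ring
    · rw [← hsp.sum_add_tsum_compl (s := insert o T), Finset.sum_insert hoT]
      have hTs : ∑ ν ∈ T, (g ν : ℝ) * P ^ (-w ν) = k * (1 / P) := by
        rw [hkdef, Finset.sum_mul]
        refine Finset.sum_congr rfl (fun ν hν => ?_)
        have : w ν = 1 := by
          have h : ν ≠ o ∧ g ν ≠ 0 ∧ w ν = 1 := by simpa [hT] using hν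
          exact h.2.2
        rw [this, Real.rpow_neg_one, one_div]
      rw [hTs, hgo, hwo]
      simp [add_assoc]
  choose R hR0 hRB hReq using hlocal
  have hsl : Summable (fun p : Nat.Primes => k * Real.log (1 - 1 / ((p : ℕ) : ℝ)) +
      Real.log (1 + (k * (1 / ((p : ℕ) : ℝ)) + R p))) := by
    have hs := (Nat.Primes.summable_rpow (r := -(1 + δ))).mpr (by linarith)
    refine Summable.of_norm_bounded (hs.mul_left (2 * k + B + (k + B) ^ 2)) (fun p => ?_)
    have hp2 : (2 : ℝ) ≤ ((p : ℕ) : ℝ) := by exact_mod_cast p.2.two_le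
    have hp0 : (0 : ℝ) < ((p : ℕ) : ℝ) := by linarith
    rw [Real.norm_eq_abs]
    refine aux_log_bound k B (R p) _ _ hk0 hB0 (hR0 p) (by positivity) ?_ (hRB p) ?_ ?_
    · exact one_div_le_one_div_of_le (by norm_num) hp2
    · rw [one_div, ← Real.rpow_neg_one]
      exact Real.rpow_le_rpow_of_exponent_le (by linarith) (by linarith)
    · have : (1 / ((p : ℕ) : ℝ)) ^ 2 = ((p : ℕ) : ℝ) ^ (-2 : ℝ) := by
        rw [Real.rpow_neg hp0.le, one_div, inv_pow]
        norm_num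
      rw [this]
      exact Real.rpow_le_rpow_of_exponent_le (by linarith) (by linarith)
  refine ⟨Real.exp (∑' p : Nat.Primes, (k * Real.log (1 - 1 / ((p : ℕ) : ℝ)) +
      Real.log (1 + (k * (1 / ((p : ℕ) : ℝ)) + R p)))), Real.exp_pos _, ?_⟩
  · convert hsl.hasSum.rexp using 1
    funext p
    have hp2 : (2 : ℝ) ≤ ((p : ℕ) : ℝ) := by exact_mod_cast p.2.two_le
    have hp0 : (0 : ℝ) < ((p : ℕ) : ℝ) := by linarith
    have hx : 1 / ((p : ℕ) : ℝ) ≤ 1 / 2 := one_div_le_one_div_of_le (by norm_num) hp2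
    have hq : 0 < 1 + (k * (1 / ((p : ℕ) : ℝ)) + R p) := by
      have := hR0 p
      positivity
    simp only [Function.comp]
    rw [hReq p, Real.exp_add, Real.exp_log hq, Real.rpow_def_of_pos (by linarith), mul_comm k (Real.log _)]

lemma aux_frontier (n : ℕ) (K : Set (Fin n → ℝ)) (hK : ∀ x ∈ K, ∀ i, 0 ≤ x i) (i₀ : Fin n)
    (c : Fin n → ℝ) (hcpos : ∀ i, 0 < c i)
    (hlb : ∀ x ∈ frontier K, 1 ≤ ∑ i, c i * x i) (x : Fin n → ℝ) (hx : x ∈ K) :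
    1 ≤ ∑ i, c i * x i ∧ (∑ i, c i * x i = 1 → x ∈ frontier K) := by
  by_cases hf : x ∈ frontier K
  · exact ⟨hlb x hf, fun _ => hf⟩
  suffices h : 1 < ∑ i, c i * x i from ⟨h.le, fun h' => absurd h' h.ne'⟩
  set y : Fin n → ℝ := fun _ => -1 with hy
  have hycl : y ∉ closure K := by
    intro h
    have hsub : closure K ⊆ {z | 0 ≤ z i₀} :=
      closure_minimal (fun z hz => hK z hz i₀) (isClosed_le continuous_const (continuous_apply i₀))
    have : (0 : ℝ) ≤ -1 := hsub h
    linarith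
  have hxi : x ∈ interior K := by
    by_contra h
    exact hf ⟨subset_closure hx, h⟩
  have hmeet : (segment ℝ x y ∩ frontier K).Nonempty := by
    by_contra hne
    have hpre : IsPreconnected (segment ℝ x y) := (convex_segment x y).isPreconnected
    obtain ⟨z, -, hz1, hz2⟩ := hpre (interior K) (closure K)ᶜ isOpen_interior
      isClosed_closure.isOpen_compl (fun z hz => by
        by_cases h1 : z ∈ interior K
        · exact Or.inl h1
        · refine Or.inr (fun h2 => hne ⟨z, hz, h2, h1⟩))
      ⟨x, left_mem_segment ℝ x y, hxi⟩ ⟨y, right_mem_segment ℝ x y, hycl⟩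
    exact hz2 (subset_closure (interior_subset hz1))
  obtain ⟨z, ⟨a, b, ha, hb, hab, rfl⟩, hz⟩ := hmeet
  have h1 := hlb _ hz
  have hb0 : 0 < b := by
    rcases hb.lt_or_eq with h | h
    · exact h
    · exfalso
      have ha1 : a = 1 := by linarith
      rw [← h, ha1] at hz
      exact hf (by simpa using hz)
  have h2 : ∑ i, c i * (a • x + b • y) i = a * (∑ i, c i * x i) - b * ∑ i, c i := by
    rw [Finset.mul_sum, Finset.mul_sum, ← Finset.sum_sub_distrib]
    refine Finset.sum_congr rfl (fun i _ => ?_)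
    simp [hy]
    ring
  have h3 : 0 < ∑ i, c i := Finset.sum_pos (fun i _ => hcpos i) ⟨i₀, Finset.mem_univ _⟩
  have h4 : 0 ≤ ∑ i, c i * x i :=
    Finset.sum_nonneg (fun i _ => mul_nonneg (hcpos i).le (hK x hx i))
  rw [h2] at h1
  have h5 : 0 < b * ∑ i, c i := by positivity
  have h6 : a * (∑ i, c i * x i) ≤ 1 * ∑ i, c i * x i :=
    mul_le_mul_of_nonneg_right (by linarith) h4
  linarith



/-- with `f, g, S*(g), F₀, c` as in Statement 8 (`F₀` compact), the
Euler product
`G(f;0) = ∏_p (1 - 1/p)^{Σ_{ν ∈ F₀ ∩ S*(g)} g(ν)} · Σ_{ν ∈ ℕ₀ⁿ} g(ν) p^{-⟨ν,c⟩}`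
converges to a strictly positive real number. -/
theorem stmt9 (n : ℕ) (f g : (Fin n → ℕ) → ℕ) (C M : ℝ) (hC : 0 < C) (hM : 0 < M)
    (hmult : ∀ m m' : Fin n → ℕ, (∀ i, 0 < m i) → (∀ i, 0 < m' i) →
      Nat.gcd (Finset.univ.lcm m) (Finset.univ.lcm m') = 1 →
      f (fun i => m i * m' i) = f m * f m')
    (huniform : ∀ p : ℕ, p.Prime → ∀ ν : Fin n → ℕ,
      f (fun i => p ^ ν i) = g ν ∧ (g ν : ℝ) ≤ C * (1 + ∑ i, (ν i : ℝ)) ^ M)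
    (hg0 : g 0 = 1)
    (hS : {ν : Fin n → ℕ | ν ≠ 0 ∧ g ν ≠ 0}.Nonempty)
    (E F₀ : Set (Fin n → ℝ))
    (hE : E = frontier (convexHull ℝ
      (⋃ ν ∈ {ν : Fin n → ℕ | ν ≠ 0 ∧ g ν ≠ 0},
        {x : Fin n → ℝ | ∀ i, (ν i : ℝ) ≤ x i})))
    (c : Fin n → ℝ) (hcpos : ∀ i, 0 < c i)
    (hglb : IsGLB ((fun x => ∑ i, c i * x i) '' E) 1)
    (hF₀ : F₀ = {x ∈ E | ∑ i, c i * x i = 1})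
    (hcompact : IsCompact F₀)
    (hdiag : ∃ t : ℝ, 0 < t ∧ (fun _ => t) ∈ F₀) :
    ∃ L : ℝ, 0 < L ∧
      HasProd (fun p : Nat.Primes =>
        (1 - 1 / ((p : ℕ) : ℝ)) ^
            (∑' ν : {ν : Fin n → ℕ // ν ≠ 0 ∧ g ν ≠ 0 ∧
                (fun i => (ν i : ℝ)) ∈ F₀}, (g ν.1 : ℝ)) *
          ∑' ν : Fin n → ℕ, (g ν : ℝ) * ((p : ℕ) : ℝ) ^ (-∑ i, (ν i : ℝ) * c i)) L := by
  -- every point of the support has weight at least one, with equality exactly on the face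
  obtain ⟨ν₀, hν₀, -⟩ := hS
  obtain ⟨i₀, -⟩ := Function.ne_iff.mp hν₀
  set K := convexHull ℝ (⋃ ν ∈ {ν : Fin n → ℕ | ν ≠ 0 ∧ g ν ≠ 0},
        {x : Fin n → ℝ | ∀ i, (ν i : ℝ) ≤ x i}) with hKdef
  have hKnn : ∀ x ∈ K, ∀ i, 0 ≤ x i := by
    intro x hx
    have hsub : K ⊆ Set.Ici (0 : Fin n → ℝ) := by
      refine convexHull_min ?_ (convex_Ici 0)
      intro z hz
      simp only [Set.mem_iUnion] at hz
      obtain ⟨ν, -, hz⟩ := hz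
      intro i
      exact le_trans (Nat.cast_nonneg (ν i)) (hz i)
    exact fun i => hsub hx i
  have hlb : ∀ x ∈ frontier K, 1 ≤ ∑ i, c i * x i := by
    intro x hx
    exact hglb.1 ⟨x, hE ▸ hx, rfl⟩
  have hmem : ∀ ν : Fin n → ℕ, ν ≠ 0 → g ν ≠ 0 → (fun i => (ν i : ℝ)) ∈ K := by
    intro ν h1 h2
    refine subset_convexHull ℝ _ ?_
    simp only [Set.mem_iUnion]
    exact ⟨ν, ⟨h1, h2⟩, fun i => le_rfl⟩
  have hcomm : ∀ ν : Fin n → ℕ, ∑ i, c i * (ν i : ℝ) = ∑ i, (ν i : ℝ) * c i := fun ν =>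
    Finset.sum_congr rfl (fun i _ => mul_comm _ _)
  have hfr := fun (ν : Fin n → ℕ) h1 h2 =>
    aux_frontier n K hKnn i₀ c hcpos hlb (fun i => (ν i : ℝ)) (hmem ν h1 h2)
  have hiff : ∀ ν : Fin n → ℕ, (ν ≠ 0 ∧ g ν ≠ 0 ∧ (fun i => (ν i : ℝ)) ∈ F₀) ↔
      (ν ≠ 0 ∧ g ν ≠ 0 ∧ ∑ i, (ν i : ℝ) * c i = 1) := by
    intro ν
    refine and_congr_right (fun h1 => and_congr_right (fun h2 => ?_))
    rw [hF₀, hE]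
    constructor
    · intro h
      rw [← hcomm]
      exact h.2
    · intro h
      rw [← hcomm] at h
      exact ⟨(hfr ν h1 h2).2 h, h⟩
  obtain ⟨L, hL, hprod⟩ := aux_main g (fun ν => ∑ i, (ν i : ℝ) * c i) 0 hg0 (by simp)
    (aux_summable n g C M hC hM (fun ν => (huniform 2 Nat.prime_two ν).2) c hcpos)
    (fun ν h1 h2 => by
      have := (hfr ν h1 h2).1
      rw [hcomm] at this
      exact this)
  refine ⟨L, hL, ?_⟩
  have hk : (∑' ν : {ν : Fin n → ℕ // ν ≠ 0 ∧ g ν ≠ 0 ∧ (fun i => (ν i : ℝ)) ∈ F₀}, (g ν.1 : ℝ)) =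
      ∑' ν : {ν : Fin n → ℕ // ν ≠ 0 ∧ g ν ≠ 0 ∧ ∑ i, (ν i : ℝ) * c i = 1}, (g ν.1 : ℝ) :=
    Equiv.tsum_eq (Equiv.subtypeEquivRight hiff)
      (fun ν : {ν : Fin n → ℕ // ν ≠ 0 ∧ g ν ≠ 0 ∧ ∑ i, (ν i : ℝ) * c i = 1} => (g ν.1 : ℝ))
  rw [hk]
  exact hprod
end

section
/- Let A be an l×(n+1) integer matrix of rank l whose rows each have coordinate sum 0, and define T(A) = {ν ∈ ℕ₀^{n+1} : Aν = 0 and ν₁⋯ν_{n+1} = 0}. Let 𝓕₀(A) be the smallest face of the Newton polyhedron of T(A)\{0} meeting the diagonal. Then dim 𝓕₀(A) ≤ n − l, and if dim 𝓕₀(A) = n − l then rank(𝓕₀(A) ∩ T*(A)) = rank(T*(A)) = n − l + 1. -/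
open Finset

/-- The Newton polyhedron of a set `I ⊆ ℝ₊ⁿ \ {0}`. -/
noncomputable def newtonPolyhedron (n : ℕ) (I : Set (Fin n → ℝ)) : Set (Fin n → ℝ) :=
  frontier (convexHull ℝ (⋃ α ∈ I, {x : Fin n → ℝ | ∀ i, α i ≤ x i}))

/-- `F` is a face of the polyhedron `E`, cut out by a polar vector `a ∈ ℝ₊ⁿ \ {0}`. -/
def IsFace (n : ℕ) (E F : Set (Fin n → ℝ)) : Prop :=
  ∃ a : Fin n → ℝ, (∀ i, 0 ≤ a i) ∧ a ≠ 0 ∧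
    F = {x ∈ E | ∑ i, a i * x i = sInf ((fun x => ∑ i, a i * x i) '' E)}

/-- `F` meets the diagonal `ℝ₊·𝟏`. -/
def MeetsDiagonal (n : ℕ) (F : Set (Fin n → ℝ)) : Prop :=
  ∃ t : ℝ, 0 < t ∧ (fun _ => t) ∈ F

open scoped Pointwise

lemma farkas_aux {W ι : Type*} [AddCommGroup W] [Module ℝ W] [DecidableEq ι] (s : Finset ι) :
    ∀ (A : ι → W →ₗ[ℝ] ℝ) (γ : W →ₗ[ℝ] ℝ),
      (∀ x, (∀ i ∈ s, 0 ≤ A i x) → 0 ≤ γ x) →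
      ∃ c : ι → ℝ, (∀ i, 0 ≤ c i) ∧ γ = ∑ i ∈ s, c i • A i := by
  induction s using Finset.induction_on with
  | empty =>
    intro A γ h
    refine ⟨0, by simp, ?_⟩
    ext x
    have h1 := h x (by simp)
    have h2 := h (-x) (by simp)
    simp at h2 ⊢
    linarith
  | insert k s hk ih =>
    intro A γ h
    by_cases h0 : ∀ x, (∀ i ∈ s, 0 ≤ A i x) → 0 ≤ γ x
    · obtain ⟨c, hc, e⟩ := ih A γ h0
      refine ⟨fun i => if i = k then 0 else c i, fun i => by dsimp; split_ifs <;> simp [hc], ?_⟩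
      rw [Finset.sum_insert hk, e]
      simp only [if_true, zero_smul, zero_add]
      refine Finset.sum_congr rfl fun i hi => ?_
      rw [if_neg (by rintro rfl; exact hk hi)]
    · push Not at h0
      obtain ⟨y, hy, hyγ⟩ := h0
      have hky : A k y < 0 := by
        by_contra hcon
        push Not at hcon
        have := h y (by
          intro i hi
          rcases Finset.mem_insert.1 hi with rfl | hi
          · exact hcon
          · exact hy i hi)
        linarith
      obtain ⟨c, hc, e⟩ := ih (fun i => A i - (A i y / A k y) • A k) (γ - (γ y / A k y) • A k) (by
        intro x hx
        have hx' := h (x - (A k x / A k y) • y) (by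
          intro i hi
          rcases Finset.mem_insert.1 hi with rfl | hi
          · simp [hky.ne]
          · have := hx i hi
            simp only [LinearMap.sub_apply, LinearMap.smul_apply, smul_eq_mul, map_sub, map_smul] at this ⊢
            have e : A i y / A k y * A k x = A k x / A k y * A i y := by ring
            linarith)
        simp only [LinearMap.sub_apply, LinearMap.smul_apply, smul_eq_mul, map_sub, map_smul] at hx' ⊢
        have e : γ y / A k y * A k x = A k x / A k y * γ y := by ring
        linarith)
      let r := γ y / A k y - ∑ i ∈ s, c i * (A i y / A k y)
      have hr : 0 ≤ r := by
        have h1 : 0 ≤ γ y / A k y := div_nonneg_of_nonpos hyγ.le hky.le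
        have h2 : ∑ i ∈ s, c i * (A i y / A k y) ≤ 0 :=
          Finset.sum_nonpos fun i hi =>
            mul_nonpos_of_nonneg_of_nonpos (hc i) (div_nonpos_of_nonneg_of_nonpos (hy i hi) hky.le)
        simp only [r]; linarith
      refine ⟨fun i => if i = k then r else c i, fun i => by dsimp; split_ifs <;> simp [hc, hr], ?_⟩
      rw [Finset.sum_insert hk]
      have e2 : ∑ i ∈ s, (if i = k then r else c i) • A i = ∑ i ∈ s, c i • A i := by
        refine Finset.sum_congr rfl fun i hi => ?_
        rw [if_neg (by rintro rfl; exact hk hi)]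
      rw [e2]
      ext x
      have e3 := LinearMap.congr_fun e x
      simp only [LinearMap.sub_apply, LinearMap.smul_apply, smul_eq_mul, LinearMap.sum_apply,
        LinearMap.add_apply, if_true, r, mul_sub, Finset.sum_sub_distrib] at e3 ⊢
      have e4 : (∑ i ∈ s, c i * (A i y / A k y)) * A k x
          = ∑ i ∈ s, c i * (A i y / A k y * A k x) := by
        rw [Finset.sum_mul]; refine Finset.sum_congr rfl fun i _ => by ring
      rw [sub_mul, e4]
      linarith

lemma exists_nat_kernel {l d : ℕ} (A : Matrix (Fin l) (Fin d) ℤ) (w : Fin d → ℝ)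
    (hw : ∀ i, 0 ≤ w i) (hA : ∀ i, ∑ j, (A i j : ℝ) * w j = 0) :
    ∃ ν : Fin d → ℕ, (∀ i, ∑ j, A i j * (ν j : ℤ) = 0) ∧ ∀ j, (ν j = 0 ↔ w j = 0) := by
  classical
  let V : Submodule ℚ ℝ := Submodule.span ℚ (Set.range w)
  have : FiniteDimensional ℚ V := FiniteDimensional.span_of_finite ℚ (Set.finite_range w)
  let b := Module.finBasis ℚ V
  let v : Fin d → V := fun j => ⟨w j, Submodule.subset_span ⟨j, rfl⟩⟩
  have hv : ∀ j, w j = ∑ k, ((b.repr (v j) k : ℚ) : ℝ) * (b k : ℝ) := by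
    intro j
    have := congrArg (Subtype.val) (b.sum_repr (v j))
    refine Eq.trans this.symm ?_
    rw [Submodule.coe_sum]
    refine Finset.sum_congr rfl fun k _ => ?_
    rw [Submodule.coe_smul, Rat.smul_def]
  have hd : DenseRange (Pi.map (fun (_ : Fin (Module.finrank ℚ V)) (q : ℚ) => (q : ℝ))) :=
    DenseRange.piMap (fun _ => Rat.denseRange_cast)
  let U : Set (Fin (Module.finrank ℚ V) → ℝ) :=
    ⋂ j ∈ {j | 0 < w j}, {r | 0 < ∑ k, ((b.repr (v j) k : ℚ) : ℝ) * r k}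
  have hU : IsOpen U := by
    refine Set.Finite.isOpen_biInter (Set.toFinite _) fun j _ => ?_
    exact isOpen_lt continuous_const (by fun_prop)
  obtain ⟨r, hr⟩ := hd.exists_mem_open hU ⟨fun k => (b k : ℝ), by
    simp only [U, Set.mem_iInter]
    intro j hj
    simp only [Set.mem_ofPred_eq] at hj ⊢
    rw [← hv]; exact hj⟩
  let f : V →ₗ[ℚ] ℚ := b.constr ℚ r
  let u : Fin d → ℚ := fun j => f (v j)
  have hu : ∀ j, u j = ∑ k, b.repr (v j) k * r k := by
    intro j
    simp [u, f, Module.Basis.constr_apply_fintype]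
  have hu0 : ∀ j, w j = 0 → u j = 0 := by
    intro j hj
    have : v j = 0 := Subtype.ext hj
    simp [u, this]
  have hupos : ∀ j, 0 < w j → 0 < u j := by
    intro j hj
    simp only [U, Set.mem_iInter] at hr
    have := hr j hj
    simp only [Set.mem_ofPred_eq, Pi.map_apply] at this
    rw [hu]
    exact_mod_cast this
  have hunn : ∀ j, 0 ≤ u j := by
    intro j
    rcases (hw j).eq_or_lt with h | h
    · rw [hu0 j h.symm]
    · exact (hupos j h).le
  have huA : ∀ i, ∑ j, (A i j : ℚ) * u j = 0 := by
    intro i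
    have : ∑ j, (A i j : ℚ) • v j = 0 := by
      apply Subtype.ext
      simpa [Rat.smul_def, v] using hA i
    have := congrArg f this
    simpa [map_sum, u] using this
  let N : ℕ := ∏ j, (u j).den
  have hN : 0 < N := Finset.prod_pos fun j _ => (u j).den_pos
  have hν : ∀ j, ∃ m : ℕ, (m : ℚ) = N * u j := by
    intro j
    obtain ⟨c, hc⟩ : (u j).den ∣ N := Finset.dvd_prod_of_mem _ (Finset.mem_univ j)
    refine ⟨c * (u j).num.toNat, ?_⟩
    have h1 : (((u j).num.toNat : ℤ) : ℚ) = (u j).num := by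
      rw [Int.toNat_of_nonneg (Rat.num_nonneg.2 (hunn j))]
    have h2 := Rat.mul_den_eq_num (u j)
    push_cast at h1 ⊢
    rw [hc, h1, ← h2]
    push_cast; ring
  choose ν hν using hν
  refine ⟨ν, fun i => ?_, fun j => ?_⟩
  · have : (((∑ j, A i j * (ν j : ℤ) : ℤ)) : ℚ) = 0 := by
      push_cast
      simp only [hν]
      rw [← mul_zero (N : ℚ), ← huA i, Finset.mul_sum]
      refine Finset.sum_congr rfl fun j _ => by ring
    exact_mod_cast this
  · have h1 : ν j = 0 ↔ u j = 0 := by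
      rw [← Nat.cast_eq_zero (R := ℚ), hν]
      simp [hN.ne']
    rw [h1]
    refine ⟨fun h => ?_, hu0 j⟩
    by_contra hne
    exact (hupos j (lt_of_le_of_ne (hw j) (Ne.symm hne))).ne' h

lemma exists_min_set {d : ℕ} (T : Set (Fin d → ℕ)) :
    ∃ M : Finset (Fin d → ℕ), (M : Set (Fin d → ℕ)) ⊆ T ∧ ∀ ν ∈ T, ∃ μ ∈ M, μ ≤ ν := by
  have : WellQuasiOrderedLE (Fin d → ℕ) := inferInstance
  have hf : {x | Minimal (· ∈ T) x}.Finite :=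
    WellQuasiOrderedLE.finite_of_isAntichain (setOfPred_minimal_antichain _)
  refine ⟨hf.toFinset, ?_, ?_⟩
  · intro x hx
    simp at hx
    exact hx.1
  · intro ν hν
    obtain ⟨m, hm, hm'⟩ := exists_minimal_le_of_wellFoundedLT (· ∈ T) ν hν
    exact ⟨m, by simpa using hm', hm⟩

abbrev upP {d : ℕ} (I : Set (Fin d → ℝ)) : Set (Fin d → ℝ) :=
  convexHull ℝ (⋃ α ∈ I, {x : Fin d → ℝ | ∀ i, α i ≤ x i})

lemma upP_eq {d : ℕ} (I : Set (Fin d → ℝ)) :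
    upP I = convexHull ℝ I + {w : Fin d → ℝ | ∀ i, 0 ≤ w i} := by
  have hc : Convex ℝ {w : Fin d → ℝ | ∀ i, 0 ≤ w i} := by
    have : {w : Fin d → ℝ | ∀ i, 0 ≤ w i} = Set.Ici 0 := by ext; simp [Pi.le_def]
    rw [this]; exact convex_Ici 0
  rw [← hc.convexHull_eq, ← convexHull_add]
  unfold upP
  congr 1
  ext x
  simp only [Set.mem_iUnion, Set.mem_ofPred_eq, Set.mem_add, exists_prop]
  constructor
  · rintro ⟨α, hα, h⟩
    exact ⟨α, hα, x - α, fun i => by simpa using h i, by simp⟩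
  · rintro ⟨α, hα, w, hw, rfl⟩
    exact ⟨α, hα, fun i => by simpa using hw i⟩

lemma upP_closed {d : ℕ} (T : Set (Fin d → ℕ)) :
    IsClosed (upP ((fun ν : Fin d → ℕ => fun j => (ν j : ℝ)) '' T)) := by
  obtain ⟨M, hM, hM'⟩ := exists_min_set T
  have e : upP ((fun ν : Fin d → ℕ => fun j => (ν j : ℝ)) '' T)
      = upP ((fun ν : Fin d → ℕ => fun j => (ν j : ℝ)) '' (M : Set (Fin d → ℕ))) := by
    unfold upP
    congr 1
    ext x
    simp only [Set.mem_iUnion, Set.mem_ofPred_eq, exists_prop, Set.exists_mem_image]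
    constructor
    · rintro ⟨ν, hν, h⟩
      obtain ⟨μ, hμ, hle⟩ := hM' ν hν
      exact ⟨μ, hμ, fun i => (Nat.cast_le.2 (hle i)).trans (h i)⟩
    · rintro ⟨ν, hν, h⟩
      exact ⟨ν, hM hν, h⟩
  rw [e, upP_eq]
  have hcl : IsClosed {w : Fin d → ℝ | ∀ i, 0 ≤ w i} := by
    have : {w : Fin d → ℝ | ∀ i, 0 ≤ w i} = Set.Ici 0 := by ext; simp [Pi.le_def]
    rw [this]; exact isClosed_Ici
  exact hcl.add_left_of_isCompact (((M.finite_toSet).image _).isCompact_convexHull ℝ)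

lemma interior_sub {d : ℕ} {P : Set (Fin d → ℝ)} {y : Fin d → ℝ} (hy : y ∈ interior P) :
    ∃ ε : ℝ, 0 < ε ∧ (fun i => y i - ε) ∈ P := by
  have hcont : Continuous (fun ε : ℝ => (fun i => y i - ε : Fin d → ℝ)) := by fun_prop
  have ho : IsOpen ((fun ε : ℝ => (fun i => y i - ε : Fin d → ℝ)) ⁻¹' interior P) :=
    isOpen_interior.preimage hcont
  have h0 : (0 : ℝ) ∈ ((fun ε : ℝ => (fun i => y i - ε : Fin d → ℝ)) ⁻¹' interior P) := by
    simpa using hy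
  obtain ⟨δ, hδ, hb⟩ := Metric.isOpen_iff.1 ho 0 h0
  refine ⟨δ / 2, by linarith, interior_subset (hb ?_)⟩
  simp [abs_of_pos hδ, hδ]

lemma exists_frontier_le {d : ℕ} {P : Set (Fin (d + 1) → ℝ)} (hP : IsClosed P)
    (hnn : ∀ x ∈ P, ∀ i, 0 ≤ x i) {x : Fin (d + 1) → ℝ} (hx : x ∈ P) :
    ∃ y ∈ frontier P, ∀ i, y i ≤ x i := by
  let S : Set ℝ := Set.Icc 0 (x 0) ∩ ((fun ε : ℝ => (fun i => x i - ε : Fin (d + 1) → ℝ)) ⁻¹' P)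
  have hS : IsCompact S := isCompact_Icc.inter_right (hP.preimage (by fun_prop))
  have hne : S.Nonempty := ⟨0, ⟨le_rfl, hnn x hx 0⟩, by simpa using hx⟩
  obtain ⟨s, hs, hmax⟩ := hS.exists_isGreatest hne
  refine ⟨fun i => x i - s, ?_, fun i => by have := hs.1.1; dsimp; linarith⟩
  rw [hP.frontier_eq]
  refine ⟨hs.2, fun hint => ?_⟩
  obtain ⟨ε, hε, h⟩ := interior_sub hint
  have h0 := hnn _ h 0
  have : s + ε ∈ S := by
    refine ⟨⟨by linarith [hs.1.1], by linarith⟩, ?_⟩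
    simpa [sub_sub] using h
  have := hmax this
  linarith

lemma ker_finrank {l n : ℕ} (A : Matrix (Fin l) (Fin (n + 1)) ℤ)
    (hrank : LinearIndependent ℚ (fun i : Fin l => fun j : Fin (n + 1) => (A i j : ℚ))) :
    Module.finrank ℝ (LinearMap.ker (Matrix.mulVecLin (A.map (fun z => (z : ℝ))))) + l = n + 1 := by
  have h : LinearIndependent ℝ (A.map (fun z => (z : ℝ))).row := by
    have := (linearIndependent_algebraMap_comp_iff (R := ℚ) (S := ℝ)).2 hrank
    have e : (A.map (fun z => (z : ℝ))).row
        = fun i : Fin l => algebraMap ℚ ℝ ∘ (fun j : Fin (n + 1) => (A i j : ℚ)) := by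
      ext i j
      simp [Matrix.row]
    rw [e]
    exact this
  have h1 := h.rank_matrix
  have h2 := LinearMap.finrank_range_add_finrank_ker (Matrix.mulVecLin (A.map (fun z => (z : ℝ))))
  simp [Matrix.rank] at h1 h2
  omega

theorem stmt17 (l n : ℕ) (hl : 0 < l) (hln : l ≤ n)
    (A : Matrix (Fin l) (Fin (n + 1)) ℤ)
    (hrank : LinearIndependent ℚ (fun i : Fin l => fun j : Fin (n + 1) => (A i j : ℚ)))
    (hrows : ∀ i, ∑ j, A i j = 0)
    (Tstar : Set (Fin (n + 1) → ℕ))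
    (hTstar : Tstar =
      {ν : Fin (n + 1) → ℕ | A.mulVec (fun j => (ν j : ℤ)) = 0 ∧ ∃ j, ν j = 0} \ {0})
    (E F₀ : Set (Fin (n + 1) → ℝ))
    (hE : E = newtonPolyhedron (n + 1)
      ((fun ν : Fin (n + 1) → ℕ => fun j => (ν j : ℝ)) '' Tstar))
    (hF₀face : IsFace (n + 1) E F₀) (hF₀diag : MeetsDiagonal (n + 1) F₀)
    (hF₀small : ∀ F : Set (Fin (n + 1) → ℝ),
      IsFace (n + 1) E F → MeetsDiagonal (n + 1) F → F₀ ⊆ F) :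
    Module.finrank ℝ ↥(vectorSpan ℝ F₀) ≤ n - l ∧
    (Module.finrank ℝ ↥(vectorSpan ℝ F₀) = n - l →
      Module.finrank ℝ ↥(Submodule.span ℝ
          ((fun ν : Fin (n + 1) → ℕ => fun j => (ν j : ℝ)) ''
            (Tstar ∩ {ν | (fun j => (ν j : ℝ)) ∈ F₀}))) = n - l + 1 ∧
      Module.finrank ℝ ↥(Submodule.span ℝ
          ((fun ν : Fin (n + 1) → ℕ => fun j => (ν j : ℝ)) '' Tstar)) = n - l + 1) := by
  classical
  set cst : (Fin (n + 1) → ℕ) → (Fin (n + 1) → ℝ) := fun ν => fun j => (ν j : ℝ) with hcst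
  set P := upP (cst '' Tstar) with hPdef
  have hEP : E = frontier P := hE
  have hPcl : IsClosed P := upP_closed Tstar
  have hPeq : P = convexHull ℝ (cst '' Tstar) + {w : Fin (n + 1) → ℝ | ∀ i, 0 ≤ w i} :=
    upP_eq _
  have hTP : ∀ ν ∈ Tstar, cst ν ∈ P := fun ν hν =>
    subset_convexHull ℝ _ (Set.mem_biUnion (Set.mem_image_of_mem _ hν) (fun i => le_rfl))
  have hEsub : E ⊆ P := by rw [hEP]; exact hPcl.frontier_subset
  -- lower bounds of linear forms on `P`
  have hlow : ∀ (b : Fin (n + 1) → ℝ) (r : ℝ), (∀ i, 0 ≤ b i) →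
      (∀ ν ∈ Tstar, r ≤ ∑ i, b i * cst ν i) → ∀ x ∈ convexHull ℝ (cst '' Tstar),
        r ≤ ∑ i, b i * x i := by
    intro b r hb h x hx
    have hconv : Convex ℝ {x : Fin (n + 1) → ℝ | r ≤ ∑ i, b i * x i} := by
      intro y hy z hz α β hα hβ hαβ
      simp only [Set.mem_ofPred_eq] at hy hz ⊢
      have e : ∑ i, b i * (α • y + β • z) i = α * ∑ i, b i * y i + β * ∑ i, b i * z i := by
        rw [Finset.mul_sum, Finset.mul_sum, ← Finset.sum_add_distrib]
        refine Finset.sum_congr rfl fun i _ => ?_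
        simp; ring
      rw [e]
      have : r = α * r + β * r := by rw [← add_mul, hαβ, one_mul]
      rw [this]
      gcongr
    refine convexHull_min ?_ hconv hx
    rintro _ ⟨ν, hν, rfl⟩
    exact h ν hν
  have hPnn : ∀ x ∈ P, ∀ i, 0 ≤ x i := by
    intro x hx i
    rw [hPeq] at hx
    obtain ⟨c, hc, w, hw, rfl⟩ := hx
    have := hlow (Pi.single i 1) 0 (fun j => by
        by_cases h : j = i
        · subst h; simp
        · simp [h]) (fun ν _ => by simp [Pi.single_apply, hcst]) c hc
    have hwi := hw i
    simp [Pi.single_apply] at this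
    simp only [Pi.add_apply]
    linarith
  obtain ⟨a, ha, ha0, hF⟩ := hF₀face
  obtain ⟨t, ht, htF⟩ := hF₀diag
  set m : ℝ := sInf ((fun x => ∑ i, a i * x i) '' E) with hm
  have hmP : ∀ x ∈ P, m ≤ ∑ i, a i * x i := by
    intro x hx
    obtain ⟨y, hy, hyx⟩ := exists_frontier_le hPcl hPnn hx
    rw [← hEP] at hy
    have h1 : m ≤ ∑ i, a i * y i := by
      refine csInf_le ⟨0, ?_⟩ ⟨y, hy, rfl⟩
      rintro _ ⟨z, hz, rfl⟩
      exact Finset.sum_nonneg fun i _ => mul_nonneg (ha i) (hPnn z (hEsub hz) i)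
    refine h1.trans (Finset.sum_le_sum fun i _ => mul_le_mul_of_nonneg_left (hyx i) (ha i))
  have htF' := htF
  rw [hF] at htF'
  obtain ⟨htE, htm⟩ := htF'
  have hasum : 0 < ∑ i, a i := by
    obtain ⟨i, hi⟩ := Function.ne_iff.1 ha0
    exact Finset.sum_pos' (fun i _ => ha i) ⟨i, Finset.mem_univ _, lt_of_le_of_ne (ha i) (Ne.symm hi)⟩
  have hmpos : 0 < m := by
    rw [← htm, ← Finset.sum_mul]
    positivity
  -- the kernel
  set K := LinearMap.ker (Matrix.mulVecLin (A.map (fun z => (z : ℝ)))) with hK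
  have hKmem : ∀ x : Fin (n + 1) → ℝ, x ∈ K ↔ ∀ i, ∑ j, (A i j : ℝ) * x j = 0 := by
    intro x
    rw [hK, LinearMap.mem_ker, Matrix.mulVecLin_apply, funext_iff]
    rfl
  have hK1 : (fun _ => t : Fin (n + 1) → ℝ) ∈ K := by
    rw [hKmem]
    intro i
    rw [← Finset.sum_mul]
    have := hrows i
    have h2 : ∑ j, (A i j : ℝ) = 0 := by exact_mod_cast this
    rw [h2, zero_mul]
  have hKT : ∀ ν ∈ Tstar, cst ν ∈ K := by
    intro ν hν
    rw [hTstar] at hν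
    rw [hKmem]
    intro i
    have : ∑ j, A i j * (ν j : ℤ) = 0 := congrFun hν.1.1 i
    have h2 : ((∑ j, A i j * (ν j : ℤ) : ℤ) : ℝ) = 0 := by rw [this]; simp
    push_cast at h2
    exact h2
  have key : ∀ w : Fin (n + 1) → ℝ, (∀ i, 0 ≤ w i) → w ∈ K → ∑ i, a i * w i = 0 → w = 0 := by
    intro w hw hwK haw
    by_contra hne
    obtain ⟨ν, hν, hν0⟩ := exists_nat_kernel A w hw ((hKmem w).1 hwK)
    have hz : ∀ i, a i * w i = 0 := by
      intro i
      exact (Finset.sum_eq_zero_iff_of_nonneg (fun i _ => mul_nonneg (ha i) (hw i))).1 haw i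
        (Finset.mem_univ i)
    have hνT : ν ∈ Tstar := by
      rw [hTstar]
      refine ⟨⟨funext hν, ?_⟩, ?_⟩
      · obtain ⟨i, hi⟩ := Function.ne_iff.1 ha0
        exact ⟨i, (hν0 i).2 ((mul_eq_zero.1 (hz i)).resolve_left hi)⟩
      · intro h
        apply hne
        ext j
        exact (hν0 j).1 (congrFun h j)
    have h1 := hmP _ (hTP ν hνT)
    have h2 : ∑ i, a i * cst ν i = 0 := by
      refine Finset.sum_eq_zero fun i _ => ?_
      rcases mul_eq_zero.1 (hz i) with h | h
      · rw [h, zero_mul]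
      · simp [hcst, (hν0 i).2 h]
    linarith
  obtain ⟨M, hMT, hM⟩ := exists_min_set Tstar
  have posdir : ∀ i, ∃ b : Fin (n + 1) → ℝ, (∀ j, 0 ≤ b j) ∧ 0 < b i ∧
      ∀ ν ∈ Tstar, ∑ j, b j * t ≤ ∑ j, b j * cst ν j := by
    intro i
    by_contra hcon
    push Not at hcon
    let B : (Fin (n + 1) ⊕ (Fin (n + 1) → ℕ)) → (Fin (n + 1) → ℝ) →ₗ[ℝ] ℝ :=
      Sum.elim (fun j => LinearMap.proj j) (fun μ => ∑ k, (cst μ k - t) • LinearMap.proj k)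
    obtain ⟨c, hc, e⟩ := farkas_aux (Finset.univ.disjSum M) B (-LinearMap.proj i) (by
      intro b hb
      by_contra hneg
      have hbi : 0 < b i := by simpa using hneg
      have hbnn : ∀ j, 0 ≤ b j := by
        intro j
        simpa [B] using hb (Sum.inl j) (by simp)
      obtain ⟨ν, hν, hlt⟩ := hcon b hbnn hbi
      obtain ⟨μ, hμ, hle⟩ := hM ν hν
      have h1 := hb (Sum.inr μ) (by simpa using hμ)
      simp only [B, Sum.elim_inr, LinearMap.sum_apply, LinearMap.smul_apply, LinearMap.proj_apply,
        smul_eq_mul] at h1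
      have h2 : ∑ k, (cst μ k - t) * b k = ∑ k, b k * cst μ k - ∑ k, b k * t := by
        rw [← Finset.sum_sub_distrib]
        refine Finset.sum_congr rfl fun k _ => by ring
      have h3 : ∑ k, b k * cst μ k ≤ ∑ k, b k * cst ν k :=
        Finset.sum_le_sum fun k _ =>
          mul_le_mul_of_nonneg_left (Nat.cast_le.2 (hle k)) (hbnn k)
      linarith)
    let w : Fin (n + 1) → ℝ :=
      (∑ μ ∈ M, c (Sum.inr μ)) • (fun _ => t) - ∑ μ ∈ M, c (Sum.inr μ) • cst μ
    have hw : ∀ k, w k = c (Sum.inl k) + (if k = i then 1 else 0) := by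
      intro k
      have e1 := LinearMap.congr_fun e (Pi.single k 1)
      simp only [Finset.sum_disjSum, B, LinearMap.neg_apply, LinearMap.add_apply,
        LinearMap.sum_apply, LinearMap.smul_apply, Sum.elim_inl, Sum.elim_inr,
        LinearMap.proj_apply, smul_eq_mul, Pi.single_apply, mul_ite, mul_one, mul_zero,
        Finset.sum_ite_eq', Finset.sum_ite_eq, Finset.mem_univ, if_true] at e1
      simp only [w, Pi.sub_apply, Pi.smul_apply, Finset.sum_apply, smul_eq_mul]
      have e2 : ∑ μ ∈ M, c (Sum.inr μ) * (cst μ k - t)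
          = ∑ μ ∈ M, c (Sum.inr μ) * cst μ k - (∑ μ ∈ M, c (Sum.inr μ)) * t := by
        rw [Finset.sum_mul, ← Finset.sum_sub_distrib]
        refine Finset.sum_congr rfl fun k _ => by ring
      rw [e2] at e1
      have e3 : (if i = k then (1 : ℝ) else 0) = if k = i then 1 else 0 := by
        simp only [eq_comm]
      rw [e3] at e1
      linarith
    have hwnn : ∀ k, 0 ≤ w k := by
      intro k
      rw [hw]
      have := hc (Sum.inl k)
      split_ifs <;> linarith
    have hwK : w ∈ K := by
      refine K.sub_mem (K.smul_mem _ hK1) (K.sum_mem fun μ hμ => K.smul_mem _ (hKT μ (hMT hμ)))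
    have haw : ∑ k, a k * w k = 0 := by
      refine le_antisymm ?_ (Finset.sum_nonneg fun k _ => mul_nonneg (ha k) (hwnn k))
      have e1 : ∑ k, a k * w k = ∑ μ ∈ M, c (Sum.inr μ) * (m - ∑ k, a k * cst μ k) := by
        simp only [w, Pi.sub_apply, Pi.smul_apply, Finset.sum_apply, smul_eq_mul, mul_sub,
          Finset.sum_sub_distrib, ← htm, Finset.mul_sum, Finset.sum_mul]
        rw [Finset.sum_comm]
        congr 1
        · refine Finset.sum_congr rfl fun _ _ => Finset.sum_congr rfl fun _ _ => by ring
        · rw [Finset.sum_comm]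
          refine Finset.sum_congr rfl fun _ _ => Finset.sum_congr rfl fun _ _ => by ring
      rw [e1]
      refine Finset.sum_nonpos fun μ hμ => mul_nonpos_of_nonneg_of_nonpos (hc _) ?_
      have := hmP _ (hTP μ (hMT hμ))
      linarith
    have h0 := congrFun (key w hwnn hwK haw) i
    rw [hw] at h0
    have := hc (Sum.inl i)
    simp at h0
    linarith
  choose b hbnn hbpos hbT using posdir
  let a' : Fin (n + 1) → ℝ := fun j => ∑ i, b i j
  have ha'pos : ∀ j, 0 < a' j := fun j =>
    Finset.sum_pos' (fun i _ => hbnn i j) ⟨j, Finset.mem_univ _, hbpos j⟩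
  have ha'T : ∀ ν ∈ Tstar, ∑ j, a' j * t ≤ ∑ j, a' j * cst ν j := by
    intro ν hν
    simp only [a', Finset.sum_mul]
    rw [Finset.sum_comm]
    refine (Finset.sum_le_sum fun i _ => hbT i ν hν).trans ?_
    rw [Finset.sum_comm]
  have ha'c := hlow a' _ (fun j => (ha'pos j).le) ha'T
  have ha'P : ∀ x ∈ P, ∑ j, a' j * t ≤ ∑ j, a' j * x j := by
    intro x hx
    rw [hPeq] at hx
    obtain ⟨c, hc, w, hw, rfl⟩ := hx
    refine (ha'c c hc).trans (Finset.sum_le_sum fun i _ => mul_le_mul_of_nonneg_left ?_ (ha'pos i).le)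
    have := hw i
    simp only [Pi.add_apply]; linarith
  have hm' : sInf ((fun x => ∑ i, a' i * x i) '' E) = ∑ j, a' j * t := by
    refine IsLeast.csInf_eq ⟨⟨_, htE, rfl⟩, ?_⟩
    rintro _ ⟨z, hz, rfl⟩
    exact ha'P z (hEsub hz)
  have hsub := hF₀small {x ∈ E | ∑ i, a' i * x i = sInf ((fun x => ∑ i, a' i * x i) '' E)}
    ⟨a', fun i => (ha'pos i).le, fun h => (ha'pos 0).ne' (congrFun h 0), rfl⟩
    ⟨t, ht, htE, hm'.symm⟩
  have hF₀conv : ∀ x ∈ F₀, x ∈ convexHull ℝ (cst '' Tstar) := by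
    intro x hx
    obtain ⟨hxE, hxa⟩ := hsub hx
    rw [hm'] at hxa
    have hxP := hEsub hxE
    rw [hPeq] at hxP
    obtain ⟨c, hc, w, hw, rfl⟩ := hxP
    have h1 := ha'c c hc
    simp only [Pi.add_apply, mul_add, Finset.sum_add_distrib] at hxa
    have h2 : ∑ i, a' i * w i = 0 :=
      le_antisymm (by linarith) (Finset.sum_nonneg fun i _ => mul_nonneg (ha'pos i).le (hw i))
    have h3 : w = 0 := by
      ext i
      have := (Finset.sum_eq_zero_iff_of_nonneg
        (fun i _ => mul_nonneg (ha'pos i).le (hw i))).1 h2 i (Finset.mem_univ i)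
      exact (mul_eq_zero.1 this).resolve_left (ha'pos i).ne'
    simpa [h3] using hc
  set G := Submodule.span ℝ (cst '' (Tstar ∩ {ν | cst ν ∈ F₀})) with hG
  have hTF : ∀ ν ∈ Tstar, ∑ i, a i * cst ν i = m → cst ν ∈ F₀ := by
    intro ν hν h
    rw [hF]
    refine ⟨?_, h⟩
    rw [hEP, hPcl.frontier_eq]
    refine ⟨hTP ν hν, fun hint => ?_⟩
    obtain ⟨ε, hε, hmem⟩ := interior_sub hint
    have h1 := hmP _ hmem
    simp only [mul_sub, Finset.sum_sub_distrib, h, ← Finset.sum_mul] at h1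
    have : 0 < (∑ i, a i) * ε := by positivity
    linarith
  have hF₀G : ∀ x ∈ F₀, x ∈ G := by
    intro x hx
    have hx2 : ∑ i, a i * x i = m := by rw [hF] at hx; exact hx.2
    have hconv : Convex ℝ {y : Fin (n + 1) → ℝ |
        m ≤ ∑ i, a i * y i ∧ (∑ i, a i * y i = m → y ∈ G)} := by
      rintro y ⟨hy, hy'⟩ z ⟨hz, hz'⟩ α β hα hβ hαβ
      have e : ∑ i, a i * (α • y + β • z) i = α * ∑ i, a i * y i + β * ∑ i, a i * z i := by
        rw [Finset.mul_sum, Finset.mul_sum, ← Finset.sum_add_distrib]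
        refine Finset.sum_congr rfl fun i _ => ?_
        simp; ring
      have hmm : m = α * m + β * m := by rw [← add_mul, hαβ, one_mul]
      have h1 : α * m ≤ α * ∑ i, a i * y i := mul_le_mul_of_nonneg_left hy hα
      have h2 : β * m ≤ β * ∑ i, a i * z i := mul_le_mul_of_nonneg_left hz hβ
      refine ⟨by rw [e]; linarith, fun h => ?_⟩
      rw [e] at h
      have h1' : α * ∑ i, a i * y i = α * m := by linarith
      have h2' : β * ∑ i, a i * z i = β * m := by linarith
      refine G.add_mem ?_ ?_
      · by_cases h0 : α = 0
        · rw [h0, zero_smul]; exact G.zero_mem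
        · exact G.smul_mem _ (hy' (mul_left_cancel₀ h0 h1'))
      · by_cases h0 : β = 0
        · rw [h0, zero_smul]; exact G.zero_mem
        · exact G.smul_mem _ (hz' (mul_left_cancel₀ h0 h2'))
    refine (convexHull_min ?_ hconv (hF₀conv x hx)).2 hx2
    rintro _ ⟨ν, hν, rfl⟩
    exact ⟨hmP _ (hTP ν hν), fun h =>
      Submodule.subset_span ⟨ν, ⟨hν, hTF ν hν h⟩, rfl⟩⟩
  have hGle : G ≤ Submodule.span ℝ (cst '' Tstar) :=
    Submodule.span_mono (Set.image_mono Set.inter_subset_left)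
  have hTK : Submodule.span ℝ (cst '' Tstar) ≤ K := by
    rw [Submodule.span_le]
    rintro _ ⟨ν, hν, rfl⟩
    exact hKT ν hν
  let φ : (Fin (n + 1) → ℝ) →ₗ[ℝ] ℝ := ∑ i, a i • LinearMap.proj i
  have hφ : ∀ x, φ x = ∑ i, a i * x i := by intro x; simp [φ]
  have hvφ : vectorSpan ℝ F₀ ≤ LinearMap.ker φ := by
    rw [vectorSpan_def, Submodule.span_le]
    rintro _ ⟨x, hx, y, hy, rfl⟩
    rw [hF] at hx hy
    change φ (x - y) = 0
    rw [map_sub, hφ, hφ, hx.2, hy.2, sub_self]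
  have hvG : vectorSpan ℝ F₀ ≤ G := by
    rw [vectorSpan_def, Submodule.span_le]
    rintro _ ⟨x, hx, y, hy, rfl⟩
    exact G.sub_mem (hF₀G x hx) (hF₀G y hy)
  have hlt : vectorSpan ℝ F₀ < G := by
    refine lt_of_le_of_ne hvG fun h => ?_
    have h1 := hF₀G _ htF
    rw [← h] at h1
    have h2 := hvφ h1
    rw [LinearMap.mem_ker, hφ, htm] at h2
    linarith
  have f1 := Submodule.finrank_lt_finrank_of_lt hlt
  have f2 := Submodule.finrank_mono hGle
  have f3 := Submodule.finrank_mono hTK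
  have f4 := ker_finrank A hrank
  rw [← hK] at f4
  refine ⟨by omega, fun h => ⟨by omega, by omega⟩⟩
end
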